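/- arXiv:math/0509077 — 2 statements merged into one kernel-verified Lean document; each statement's English description precedes it below -/
import Mathlib

section
/- (Lemma 3.2 of the paper.) There exists a constant c > 0, depending only on χ and not on N or T, such that for all real numbers N ≥ T ≥ 1 the following bounds hold: (1) |∫_ℝ w_{N,T}(t,t) dt| ≤ c·T; (2) ŵ_{N,T}(ξ) ≥ 0 for all ξ ∈ ℝ; (3) ŵ_{N,T}(ξ) ≥ 1/2 for all ξ ∈ ℝ with |ξ − N| ≤ T; (4) |w^♭_{N,T}(s)| ≤ c·T·N^{−1/2} for all purely imaginary s with |s| ≤ N/T; (5) |w^♭_{N,T}(s)| ≤ c·T·(1+|s|)^{−3} for all purely imaginary s with |s| ≥ N/T. -/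
open MeasureTheory

/-- `r ^ z := exp(z · log r)` for `r > 0` (junk value `exp 0 = 1` at `r = 0`). -/
noncomputable def rpowC (r : ℝ) (z : ℂ) : ℂ := Complex.exp (z * (Real.log r : ℂ))

/-- `ŵ(ξ) = ∫_{ℝ²} w(x,y)·e^{−iξ(x−y)} dx dy`. -/
noncomputable def fourierW (w : ℝ × ℝ → ℂ) (ξ : ℝ) : ℂ :=
  ∫ p : ℝ × ℝ, w p * Complex.exp (-Complex.I * (ξ : ℂ) * ((p.1 : ℂ) - (p.2 : ℂ)))

/-- `w^♭(s) = ∫_{ℝ²} w(x,y)·|x−y|^{(−s−1)/2} dx dy`. -/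
noncomputable def flatW (w : ℝ × ℝ → ℂ) (s : ℂ) : ℂ :=
  ∫ p : ℝ × ℝ, w p * rpowC |p.1 - p.2| ((-s - 1) / 2)

/-- The oscillating factor `exp (i (M x² - 2 l log x))`. -/
noncomputable def quadLogWave (M l x : ℝ) : ℂ :=
  Complex.exp (((M * x ^ 2 - 2 * l * Real.log x : ℝ) : ℂ) * Complex.I)

lemma norm_quadLogWave (M l x : ℝ) : ‖quadLogWave M l x‖ = 1 :=
  Complex.norm_exp_ofReal_mul_I _

lemma measurable_quadLogWave (M l : ℝ) : Measurable (quadLogWave M l) := by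
  unfold quadLogWave
  fun_prop

lemma hasDerivAt_quadLogWave (M l : ℝ) {x : ℝ} (hx : x ≠ 0) :
    HasDerivAt (quadLogWave M l)
      (Complex.I * ((2 * M * x - 2 * l / x : ℝ) : ℂ) * quadLogWave M l x) x := by
  have h1 : HasDerivAt (fun x : ℝ => M * x ^ 2 - 2 * l * Real.log x) (2 * M * x - 2 * l / x) x := by
    have := ((hasDerivAt_pow 2 x).const_mul M).sub
      ((Real.hasDerivAt_log hx).const_mul (2 * l))
    refine this.congr_deriv ?_
    simp only [Nat.cast_ofNat]
    ring
  have h2 := (h1.ofReal_comp.mul_const Complex.I).cexp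
  refine h2.congr_deriv ?_
  simp only [quadLogWave]
  ring

lemma intervalIntegrable_mul_quadLogWave {b : ℝ → ℂ} (hb : Continuous b) (M l u v : ℝ) :
    IntervalIntegrable (fun x => b x * quadLogWave M l x) volume u v := by
  have h : ∀ s, IntegrableOn b s → IntegrableOn (fun x => b x * quadLogWave M l x) s :=
    fun s hs => Integrable.mul_bdd (c := 1) hs (measurable_quadLogWave M l).aestronglyMeasurable
      (Filter.Eventually.of_forall fun x => (norm_quadLogWave M l x).le)
  exact ⟨h _ (hb.intervalIntegrable u v).1, h _ (hb.intervalIntegrable u v).2⟩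

/-- Integration by parts against an oscillating factor `G` with nonvanishing phase derivative
`θ = 1 / p`. -/
lemma norm_integral_mul_le_of_nonstationary {a b C ε : ℝ} (hab : a ≤ b) (hlen : b - a ≤ 1)
    {B G : ℝ → ℂ} {θ p p' P P' : ℝ → ℝ} (hB : ContDiff ℝ 1 B)
    (hBC : ∀ x ∈ Set.Icc a b, ‖B x‖ ≤ C) (hBC' : ∀ x ∈ Set.Icc a b, ‖deriv B x‖ ≤ C)
    (hG : ∀ x ∈ Set.Icc a b, HasDerivAt G (Complex.I * (θ x : ℂ) * G x) x)
    (hG1 : ∀ x, ‖G x‖ = 1)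
    (hp : ∀ x ∈ Set.Icc a b, HasDerivAt p (p' x) x) (hpθ : ∀ x ∈ Set.Icc a b, p x * θ x = 1)
    (hp'c : ContinuousOn p' (Set.Icc a b)) (hpε : ∀ x ∈ Set.Icc a b, |p x| ≤ ε)
    (hP : ∀ x ∈ Set.Icc a b, HasDerivAt P (P' x) x) (hP'c : ContinuousOn P' (Set.Icc a b))
    (hp'P' : ∀ x ∈ Set.Icc a b, |p' x| ≤ P' x) (hPε : P b - P a ≤ ε) :
    ‖∫ x in a..b, B x * G x‖ ≤ 4 * C * ε := by
  have hBc : ContinuousOn B (Set.Icc a b) := hB.continuous.continuousOn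
  have hB'c : ContinuousOn (deriv B) (Set.Icc a b) := (hB.continuous_deriv le_rfl).continuousOn
  have hGc : ContinuousOn G (Set.Icc a b) := fun x hx => (hG x hx).continuousAt.continuousWithinAt
  have hpc : ContinuousOn p (Set.Icc a b) := fun x hx => (hp x hx).continuousAt.continuousWithinAt
  have hpc' : ContinuousOn (fun x => (p x : ℂ)) (Set.Icc a b) :=
    Complex.continuous_ofReal.comp_continuousOn hpc
  have hp'c' : ContinuousOn (fun x => (p' x : ℂ)) (Set.Icc a b) :=
    Complex.continuous_ofReal.comp_continuousOn hp'c
  have hu : Set.uIcc a b = Set.Icc a b := Set.uIcc_of_le hab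
  have ha : a ∈ Set.Icc a b := ⟨le_rfl, hab⟩
  have hb : b ∈ Set.Icc a b := ⟨hab, le_rfl⟩
  have hC : 0 ≤ C := (norm_nonneg _).trans (hBC a ha)
  have hε : 0 ≤ ε := (abs_nonneg _).trans (hpε a ha)
  have i1 : IntervalIntegrable (fun x => deriv B x * p x * G x) volume a b :=
    ContinuousOn.intervalIntegrable (by rw [hu]; exact (hB'c.mul hpc').mul hGc)
  have i2 : IntervalIntegrable (fun x => B x * p' x * G x) volume a b :=
    ContinuousOn.intervalIntegrable (by rw [hu]; exact (hBc.mul hp'c').mul hGc)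
  have i3 : IntervalIntegrable (fun x => Complex.I * (B x * G x)) volume a b :=
    ContinuousOn.intervalIntegrable
      (by rw [hu]; exact continuousOn_const.mul (hBc.mul hGc))
  have key : ∫ x in a..b, (deriv B x * p x * G x + B x * p' x * G x + Complex.I * (B x * G x)) =
      B b * p b * G b - B a * p a * G a := by
    refine intervalIntegral.integral_eq_sub_of_hasDerivAt (f := fun x => B x * p x * G x) ?_
      ((i1.add i2).add i3)
    intro x hx
    rw [hu] at hx
    have h1 := (((hB.differentiable one_ne_zero x).hasDerivAt).mul
      (hp x hx).ofReal_comp).mul (hG x hx)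
    refine h1.congr_deriv ?_
    have h2 : (p x : ℂ) * (θ x : ℂ) = 1 := by exact_mod_cast hpθ x hx
    simp only [Pi.mul_apply]
    linear_combination (Complex.I * B x * G x) * h2
  rw [intervalIntegral.integral_add (i1.add i2) i3, intervalIntegral.integral_add i1 i2,
    intervalIntegral.integral_const_mul] at key
  have n1 : ‖∫ x in a..b, deriv B x * p x * G x‖ ≤ C * ε := by
    refine (intervalIntegral.norm_integral_le_of_norm_le_const (C := C * ε) ?_).trans ?_
    · intro x hx
      have hx' : x ∈ Set.Icc a b := by rw [← hu]; exact Set.uIoc_subset_uIcc hx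
      rw [norm_mul, norm_mul, hG1, mul_one, Complex.norm_real]
      exact mul_le_mul (hBC' x hx') (hpε x hx') (norm_nonneg _) hC
    · rw [abs_of_nonneg (sub_nonneg.2 hab)]
      exact mul_le_of_le_one_right (mul_nonneg hC hε) hlen
  have n2 : ‖∫ x in a..b, B x * p' x * G x‖ ≤ C * ε := by
    have hP'i : IntervalIntegrable P' volume a b :=
      ContinuousOn.intervalIntegrable (by rwa [hu])
    calc _ ≤ ∫ x in a..b, C * P' x := by
          refine intervalIntegral.norm_integral_le_of_norm_le hab ?_ (hP'i.const_mul C)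
          refine Filter.Eventually.of_forall fun x hx => ?_
          have hx' : x ∈ Set.Icc a b := Set.Ioc_subset_Icc_self hx
          rw [norm_mul, norm_mul, hG1, mul_one, Complex.norm_real]
          exact mul_le_mul (hBC x hx') (hp'P' x hx') (norm_nonneg _) hC
      _ = C * (P b - P a) := by
          rw [intervalIntegral.integral_const_mul,
            intervalIntegral.integral_eq_sub_of_hasDerivAt (fun x hx => hP x (hu ▸ hx)) hP'i]
      _ ≤ C * ε := mul_le_mul_of_nonneg_left hPε hC
  have nF : ∀ x ∈ Set.Icc a b, ‖B x * p x * G x‖ ≤ C * ε := by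
    intro x hx
    rw [norm_mul, norm_mul, hG1, mul_one, Complex.norm_real]
    exact mul_le_mul (hBC x hx) (hpε x hx) (norm_nonneg _) hC
  have e : Complex.I * ∫ x in a..b, B x * G x = B b * p b * G b - B a * p a * G a -
      (∫ x in a..b, deriv B x * p x * G x) - ∫ x in a..b, B x * p' x * G x := by
    linear_combination key
  have e' : ‖∫ x in a..b, B x * G x‖ = ‖B b * p b * G b - B a * p a * G a -
      (∫ x in a..b, deriv B x * p x * G x) - ∫ x in a..b, B x * p' x * G x‖ := by
    rw [← e, norm_mul, Complex.norm_I, one_mul]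
  rw [e']
  have t1 := norm_sub_le (B b * p b * G b - B a * p a * G a -
      (∫ x in a..b, deriv B x * p x * G x)) (∫ x in a..b, B x * p' x * G x)
  have t2 := norm_sub_le (B b * p b * G b - B a * p a * G a)
      (∫ x in a..b, deriv B x * p x * G x)
  have t3 := norm_sub_le (B b * p b * G b) (B a * p a * G a)
  linarith [nF a ha, nF b hb]

/-- The bound on an interval at distance at least `δ` from the critical point `√(l / M)`. -/
lemma norm_integral_mul_quadLogWave_le_of_dist {B : ℝ → ℂ} {C M l a b δ : ℝ}
    (hB : ContDiff ℝ 1 B) (hBC : ∀ x ∈ Set.Icc (0 : ℝ) 1, ‖B x‖ ≤ C)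
    (hBC' : ∀ x ∈ Set.Icc (0 : ℝ) 1, ‖deriv B x‖ ≤ C) (hM : M ≠ 0)
    (ha : 0 < a) (hab : a ≤ b) (hb : b ≤ 1) (hδ : 0 < δ)
    (hd : b ≤ √(l / M) - δ ∨ √(l / M) + δ ≤ a) :
    ‖∫ x in a..b, B x * quadLogWave M l x‖ ≤ 4 * C * (2 * |M| * δ)⁻¹ := by
  set ρ := l / M with hρ
  set r := √ρ with hr
  have hr0 : 0 ≤ r := Real.sqrt_nonneg _
  have hM' : 0 < |M| := abs_pos.2 hM
  have hdx : ∀ x ∈ Set.Icc a b, δ ≤ |x - r| := by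
    intro x hx
    rcases hd with h | h
    · rw [abs_sub_comm]
      exact le_trans (by linarith [hx.2]) (le_abs_self _)
    · exact le_trans (by linarith [hx.1]) (le_abs_self _)
  have hρr : (0 ≤ ρ ∧ ρ = r ^ 2) ∨ (ρ < 0 ∧ r = 0) := by
    rcases le_or_gt 0 ρ with h | h
    · exact Or.inl ⟨h, (Real.sq_sqrt h).symm⟩
    · exact Or.inr ⟨h, Real.sqrt_eq_zero_of_nonpos h.le⟩
  have hsub : ∀ x ∈ Set.Icc a b, x * |x - r| ≤ |x ^ 2 - ρ| := by
    intro x hx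
    have hx0 : 0 < x := ha.trans_le hx.1
    rcases hρr with ⟨_, h⟩ | ⟨h, h'⟩
    · rw [h, show x ^ 2 - r ^ 2 = (x + r) * (x - r) by ring, abs_mul,
        abs_of_nonneg (by linarith : 0 ≤ x + r)]
      exact mul_le_mul_of_nonneg_right (by linarith) (abs_nonneg _)
    · rw [h', sub_zero, abs_of_pos hx0]
      exact le_trans (by nlinarith) (le_abs_self _)
  have hsq : ∀ x ∈ Set.Icc a b, |x ^ 2 + ρ| * (x - r) ^ 2 ≤ (x ^ 2 - ρ) ^ 2 := by
    intro x hx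
    have hx0 : 0 < x := ha.trans_le hx.1
    rcases hρr with ⟨h0, h⟩ | ⟨h, h'⟩
    · rw [abs_of_nonneg (by positivity), h,
        show (x ^ 2 - r ^ 2) ^ 2 = (x + r) ^ 2 * (x - r) ^ 2 by ring]
      exact mul_le_mul_of_nonneg_right (by nlinarith) (sq_nonneg _)
    · rw [h', sub_zero, sq (x ^ 2 - ρ)]
      refine mul_le_mul ?_ (by linarith) (sq_nonneg _) (by nlinarith)
      rw [abs_le]
      constructor <;> nlinarith
  have hne : ∀ x ∈ Set.Icc a b, x ^ 2 - ρ ≠ 0 := by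
    intro x hx
    have := hsub x hx
    have h2 : 0 < x * |x - r| := mul_pos (ha.trans_le hx.1) (hδ.trans_le (hdx x hx))
    exact abs_pos.1 (h2.trans_le this)
  have hne' : ∀ x ∈ Set.Icc a b, x - r ≠ 0 := fun x hx =>
    abs_pos.1 (hδ.trans_le (hdx x hx))
  refine norm_integral_mul_le_of_nonstationary hab (by linarith) hB
    (fun x hx => hBC x ⟨ha.le.trans hx.1, hx.2.trans hb⟩)
    (fun x hx => hBC' x ⟨ha.le.trans hx.1, hx.2.trans hb⟩)
    (fun x hx => hasDerivAt_quadLogWave M l (ha.trans_le hx.1).ne') (norm_quadLogWave M l)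
    (p := fun x => x / (2 * M * (x ^ 2 - ρ)))
    (p' := fun x => -(x ^ 2 + ρ) / (2 * M * (x ^ 2 - ρ) ^ 2))
    (P := fun x => -(2 * |M| * (x - r))⁻¹)
    (P' := fun x => 1 / (2 * |M| * (x - r) ^ 2)) ?_ ?_ ?_ ?_ ?_ ?_ ?_ ?_
  · intro x hx
    have h0 := hne x hx
    have h1 : HasDerivAt (fun x : ℝ => 2 * M * (x ^ 2 - ρ)) (2 * M * (2 * x)) x := by
      have := ((hasDerivAt_pow 2 x).sub_const ρ).const_mul (2 * M)
      refine this.congr_deriv ?_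
      simp
    refine ((hasDerivAt_id x).div h1 (by simp [hM, h0])).congr_deriv ?_
    simp only [id]
    field_simp
    ring
  · intro x hx
    have h0 := hne x hx
    have hx0 : x ≠ 0 := (ha.trans_le hx.1).ne'
    have hl : l = ρ * M := by rw [hρ]; field_simp
    simp only [hl]
    field_simp
  · refine ContinuousOn.div (by fun_prop) (by fun_prop) fun x hx => ?_
    have h0 := hne x hx
    simp [hM, h0]
  · intro x hx
    have h0 := hne x hx
    have hx0 : 0 < x := ha.trans_le hx.1
    rw [abs_div, abs_mul, abs_mul, abs_of_pos hx0, abs_two, inv_eq_one_div,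
      div_le_div_iff₀ (by positivity) (by positivity)]
    have := mul_le_mul_of_nonneg_left (hdx x hx) hx0.le
    have := hsub x hx
    nlinarith
  · intro x hx
    have h0 := hne' x hx
    have h1 : HasDerivAt (fun x : ℝ => 2 * |M| * (x - r)) (2 * |M| * 1) x :=
      ((hasDerivAt_id x).sub_const r).const_mul (2 * |M|)
    refine (h1.inv (by positivity)).neg.congr_deriv ?_
    field_simp
  · refine ContinuousOn.div (by fun_prop) (by fun_prop) fun x hx => ?_
    have h0 := hne' x hx
    positivity
  · intro x hx
    have h0 := hne x hx
    have h1 := hne' x hx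
    rw [abs_div, abs_neg, abs_mul, abs_mul, abs_two, abs_of_nonneg (sq_nonneg (x ^ 2 - ρ)),
      div_le_div_iff₀ (by positivity) (by positivity)]
    have := hsq x hx
    nlinarith
  · have hinv : ∀ t : ℝ, δ ≤ t → (2 * |M| * t)⁻¹ ≤ (2 * |M| * δ)⁻¹ := fun t ht =>
      inv_anti₀ (by positivity) (by gcongr)
    rcases hd with h | h
    · have h1 := hinv (r - b) (by linarith)
      have h2 : 0 ≤ (2 * |M| * (r - a))⁻¹ := inv_nonneg.2 (mul_nonneg (by positivity) (by linarith))
      rw [show 2 * |M| * (b - r) = -(2 * |M| * (r - b)) by ring,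
        show 2 * |M| * (a - r) = -(2 * |M| * (r - a)) by ring, inv_neg, inv_neg]
      linarith
    · have h1 := hinv (a - r) (by linarith)
      have h2 : 0 ≤ (2 * |M| * (b - r))⁻¹ := inv_nonneg.2 (mul_nonneg (by positivity) (by linarith))
      linarith

/-- A uniform stationary phase bound. -/
lemma norm_integral_mul_quadLogWave_le {B : ℝ → ℂ} {C M : ℝ} (hB : ContDiff ℝ 1 B)
    (hBC : ∀ x ∈ Set.Icc (0 : ℝ) 1, ‖B x‖ ≤ C)
    (hBC' : ∀ x ∈ Set.Icc (0 : ℝ) 1, ‖deriv B x‖ ≤ C) (hM : 1 ≤ |M|) (l : ℝ) :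
    ‖∫ x in (0 : ℝ)..1, B x * quadLogWave M l x‖ ≤ 7 * C * |M| ^ (-(1 : ℝ) / 2) := by
  have hMp : 0 < |M| := by linarith
  have hM0 : M ≠ 0 := abs_pos.1 hMp
  set δ := |M| ^ (-(1 : ℝ) / 2) with hδ
  have hδ0 : 0 < δ := Real.rpow_pos_of_pos hMp _
  have hδ1 : δ ≤ 1 := Real.rpow_le_one_of_one_le_of_nonpos hM (by norm_num)
  have hMδ : |M| * δ * δ = 1 := by
    rw [mul_assoc, hδ, ← Real.rpow_add hMp]
    norm_num
    rw [Real.rpow_neg_one]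
    field_simp
  have hinv : (2 * |M| * δ)⁻¹ = δ / 2 := by
    have : 2 * |M| * δ ≠ 0 := by positivity
    field_simp
    linarith
  have hC : 0 ≤ C := (norm_nonneg _).trans (hBC 0 (by simp))
  set r := √(l / M) with hr
  have hr0 : 0 ≤ r := Real.sqrt_nonneg _
  set t₁ := max δ (min 1 (r - δ)) with ht₁
  set t₂ := max δ (min 1 (r + δ)) with ht₂
  have h1 : δ ≤ t₁ := le_max_left _ _
  have h12 : t₁ ≤ t₂ := max_le_max le_rfl (min_le_min le_rfl (by linarith))
  have h2 : t₂ ≤ 1 := max_le hδ1 (min_le_left _ _)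
  have h21 : t₂ - t₁ ≤ 2 * δ := by
    rcases max_cases δ (min 1 (r - δ)) with h | h <;>
    rcases max_cases δ (min 1 (r + δ)) with h' | h' <;>
    rcases min_cases 1 (r - δ) with g | g <;>
    rcases min_cases 1 (r + δ) with g' | g' <;> linarith
  have triv : ∀ u v : ℝ, 0 ≤ u → u ≤ v → v ≤ 1 →
      ‖∫ x in u..v, B x * quadLogWave M l x‖ ≤ C * (v - u) := by
    intro u v hu huv hv
    rw [← abs_of_nonneg (sub_nonneg.2 huv)]
    refine intervalIntegral.norm_integral_le_of_norm_le_const fun x hx => ?_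
    rw [Set.uIoc_of_le huv] at hx
    rw [norm_mul, norm_quadLogWave, mul_one]
    exact hBC x ⟨hu.trans hx.1.le, hx.2.trans hv⟩
  have b1 := triv 0 δ le_rfl hδ0.le hδ1
  have b3 := triv t₁ t₂ (by linarith) h12 h2
  have b2 : ‖∫ x in δ..t₁, B x * quadLogWave M l x‖ ≤ 4 * C * (δ / 2) := by
    rw [← hinv]
    rcases eq_or_lt_of_le h1 with h | h
    · rw [← h, intervalIntegral.integral_same, norm_zero]
      positivity
    · refine norm_integral_mul_quadLogWave_le_of_dist hB hBC hBC' hM0 hδ0 h1 (by linarith) hδ0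
        (Or.inl ?_)
      rcases max_cases δ (min 1 (r - δ)) with g | g
      · linarith
      · exact g.1.le.trans (min_le_right _ _)
  have b4 : ‖∫ x in t₂..1, B x * quadLogWave M l x‖ ≤ 4 * C * (δ / 2) := by
    rw [← hinv]
    rcases eq_or_lt_of_le h2 with h | h
    · rw [h, intervalIntegral.integral_same, norm_zero]
      positivity
    · refine norm_integral_mul_quadLogWave_le_of_dist hB hBC hBC' hM0 (by linarith) h2 le_rfl hδ0
        (Or.inr ?_)
      have g1 : min 1 (r + δ) ≤ t₂ := le_max_right _ _
      rcases min_cases 1 (r + δ) with g | g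
      · linarith
      · linarith
  have ii := intervalIntegrable_mul_quadLogWave hB.continuous M l
  rw [← intervalIntegral.integral_add_adjacent_intervals (ii 0 t₂) (ii t₂ 1),
    ← intervalIntegral.integral_add_adjacent_intervals (ii 0 t₁) (ii t₁ t₂),
    ← intervalIntegral.integral_add_adjacent_intervals (ii 0 δ) (ii δ t₁)]
  have q1 := norm_add_le ((∫ x in (0 : ℝ)..δ, B x * quadLogWave M l x) +
    (∫ x in δ..t₁, B x * quadLogWave M l x) + ∫ x in t₁..t₂, B x * quadLogWave M l x)
    (∫ x in t₂..1, B x * quadLogWave M l x)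
  have q2 := norm_add_le ((∫ x in (0 : ℝ)..δ, B x * quadLogWave M l x) +
    (∫ x in δ..t₁, B x * quadLogWave M l x)) (∫ x in t₁..t₂, B x * quadLogWave M l x)
  have q3 := norm_add_le (∫ x in (0 : ℝ)..δ, B x * quadLogWave M l x)
    (∫ x in δ..t₁, B x * quadLogWave M l x)
  have q4 := mul_le_mul_of_nonneg_left h21 hC
  linarith

/-- One integration by parts against `quadLogWave` in the absence of critical points. -/
lemma integral_mul_quadLogWave_eq_of_antideriv {b F F' : ℝ → ℂ} {h l : ℝ}
    (hb : Continuous b) (hF : ∀ x, HasDerivAt F (F' x) x) (hF' : Continuous F')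
    (hF0 : F 0 = 0) (hF1 : F 1 = 0)
    (hFb : ∀ x ∈ Set.Ioo (0 : ℝ) 1, ((1 - h * x ^ 2 : ℝ) : ℂ) * F x = x * b x) :
    2 * |l| * ‖∫ x in (0 : ℝ)..1, b x * quadLogWave (h * l) l x‖ =
      ‖∫ x in (0 : ℝ)..1, F' x * quadLogWave (h * l) l x‖ := by
  have i1 := intervalIntegrable_mul_quadLogWave hF' (h * l) l 0 1
  have i2 := (intervalIntegrable_mul_quadLogWave hb (h * l) l 0 1).const_mul (2 * l * Complex.I)
  have hFc : Continuous F := continuous_iff_continuousAt.2 fun x => (hF x).continuousAt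
  have key : ∫ x in (0 : ℝ)..1, (F' x * quadLogWave (h * l) l x -
      2 * l * Complex.I * (b x * quadLogWave (h * l) l x)) =
      F 1 * quadLogWave (h * l) l 1 - F 0 * quadLogWave (h * l) l 0 := by
    refine intervalIntegral.integral_eq_sub_of_hasDerivAt_of_le
      (f := fun x => F x * quadLogWave (h * l) l x) zero_le_one ?_ ?_ (i1.sub i2)
    · intro x hx
      rcases eq_or_ne x 0 with rfl | hx0
      · refine ContinuousAt.continuousWithinAt ?_
        rw [ContinuousAt, hF0, zero_mul]
        refine Filter.Tendsto.zero_mul_isBoundedUnder_le ?_ ?_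
        · simpa [hF0] using hFc.tendsto 0
        · refine Filter.isBoundedUnder_of ⟨1, fun x => ?_⟩
          simp [norm_quadLogWave]
      · exact (hFc.continuousAt.mul
          (hasDerivAt_quadLogWave (h * l) l hx0).continuousAt).continuousWithinAt
    · intro x hx
      have hx0 : x ≠ 0 := hx.1.ne'
      refine ((hF x).mul (hasDerivAt_quadLogWave (h * l) l hx0)).congr_deriv ?_
      have h1 := hFb x hx
      have hxc : (x : ℂ) ≠ 0 := by exact_mod_cast hx0
      push_cast at h1 ⊢
      have h2 : b x = (1 - h * x ^ 2) * F x / x := by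
        rw [h1]
        field_simp
      rw [h2]
      field_simp
      ring
  rw [intervalIntegral.integral_sub i1 i2, intervalIntegral.integral_const_mul, hF0, hF1,
    zero_mul, zero_mul, sub_zero, sub_eq_zero] at key
  rw [key, norm_mul, norm_mul, norm_mul, Complex.norm_I, Complex.norm_real, mul_one]
  simp

/-- A smooth function agreeing with `y ↦ (1 - y)⁻¹` for `|y| ≤ 1 / 2`. -/
lemma exists_contDiff_eq_inv_one_sub :
    ∃ Q : ℝ → ℝ, ContDiff ℝ (⊤ : ℕ∞) Q ∧ ∀ y, |y| ≤ 1 / 2 → (1 - y) * Q y = 1 := by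
  let f : ContDiffBump (0 : ℝ) := ⟨1 / 2, 3 / 4, by norm_num, by norm_num⟩
  have hne : ∀ y, 1 - y * f y ≠ 0 := by
    intro y hy
    rcases lt_or_ge |y| (3 / 4) with h | h
    · have h1 := f.le_one (x := y)
      have h2 := f.nonneg (x := y)
      have h3 := (abs_lt.1 h).2
      nlinarith
    · rw [f.zero_of_le_dist (by simpa using h)] at hy
      norm_num at hy
  refine ⟨fun y => (1 - y * f y)⁻¹, ?_, fun y hy => ?_⟩
  · exact (contDiff_const.sub (contDiff_id.mul f.contDiff)).inv hne
  · have h1 : f y = 1 := f.one_of_mem_closedBall (mem_closedBall_zero_iff.2 hy)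
    have h2 := hne y
    rw [h1, mul_one] at h2
    simp only [h1, mul_one]
    exact mul_inv_cancel₀ h2

/-- Integration by parts for a smooth family of amplitudes supported in `x ≤ 1 / 2`. -/
lemma exists_amplitude_integral_mul_quadLogWave_eq {B : ℝ × ℝ → ℂ} (hB : ContDiff ℝ (⊤ : ℕ∞) B)
    (hB0 : ∀ h x : ℝ, 1 / 2 < x → B (h, x) = 0) :
    ∃ B₁ : ℝ × ℝ → ℂ, ContDiff ℝ (⊤ : ℕ∞) B₁ ∧ (∀ h x : ℝ, 1 / 2 < x → B₁ (h, x) = 0) ∧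
      ∀ h l : ℝ, |h| ≤ 2 →
        2 * |l| * ‖∫ x in (0 : ℝ)..1, B (h, x) * quadLogWave (h * l) l x‖ =
          ‖∫ x in (0 : ℝ)..1, B₁ (h, x) * quadLogWave (h * l) l x‖ := by
  obtain ⟨Q, hQ, hQ1⟩ := exists_contDiff_eq_inv_one_sub
  let F : ℝ × ℝ → ℂ := fun z => ((z.2 * Q (z.1 * z.2 ^ 2) : ℝ) : ℂ) * B z
  have hF : ContDiff ℝ (⊤ : ℕ∞) F := by
    refine ContDiff.mul (Complex.ofRealCLM.contDiff.comp
      (contDiff_snd.mul (hQ.comp (contDiff_fst.mul (contDiff_snd.pow 2))))) hB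
  have hF0 : ∀ h x : ℝ, 1 / 2 < x → F (h, x) = 0 := fun h x hx => by simp [F, hB0 h x hx]
  have hd : ∀ h x : ℝ, HasDerivAt (fun x => F (h, x)) (fderiv ℝ F (h, x) (0, 1)) x := fun h x =>
    ((hF.differentiable (by simp)) (h, x)).hasFDerivAt.comp_hasDerivAt x
      ((hasDerivAt_const x h).prodMk (hasDerivAt_id x))
  have hB₁ : ContDiff ℝ (⊤ : ℕ∞) fun z => fderiv ℝ F z (0, 1) :=
    (hF.fderiv_right (m := (⊤ : ℕ∞)) (by simp)).clm_apply contDiff_const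
  refine ⟨fun z => fderiv ℝ F z (0, 1), hB₁, fun h x hx => ?_, fun h l hh => ?_⟩
  · refine (hd h x).unique ((hasDerivAt_const x (0 : ℂ)).congr_of_eventuallyEq ?_)
    filter_upwards [lt_mem_nhds hx] with y hy using hF0 h y hy
  · refine integral_mul_quadLogWave_eq_of_antideriv (F := fun x => F (h, x))
      (hB.continuous.comp (by fun_prop)) (hd h) (hB₁.continuous.comp (by fun_prop))
      (by simp [F]) (hF0 h 1 (by norm_num)) fun x hx => ?_
    rcases lt_or_ge (1 / 2) x with h1 | h1
    · simp only [hF0 h x h1, hB0 h x h1, mul_zero]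
    · have hx0 := hx.1
      have h2 : |h * x ^ 2| ≤ 1 / 2 := by
        rw [abs_mul, abs_of_nonneg (sq_nonneg x)]
        nlinarith [abs_nonneg h]
      have h3 : ((1 - h * x ^ 2 : ℝ) : ℂ) * (Q (h * x ^ 2) : ℂ) = 1 := by
        exact_mod_cast hQ1 _ h2
      simp only [F, Complex.ofReal_mul]
      linear_combination (x * B (h, x)) * h3

/-- Cubic decay in the absence of critical points on the support of the amplitude. -/
lemma exists_norm_integral_mul_quadLogWave_le_inv_pow {b : ℝ → ℂ} (hb : ContDiff ℝ (⊤ : ℕ∞) b)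
    (hb0 : ∀ x : ℝ, 1 / 2 < x → b x = 0) :
    ∃ C : ℝ, ∀ M l : ℝ, l ≠ 0 → |M| ≤ 2 * |l| →
      (2 * |l|) ^ 3 * ‖∫ x in (0 : ℝ)..1, b x * quadLogWave M l x‖ ≤ C := by
  obtain ⟨B₁, h1, h1', e1⟩ := exists_amplitude_integral_mul_quadLogWave_eq
    (B := fun z => b z.2) (hb.comp contDiff_snd) (fun _ x hx => hb0 x hx)
  obtain ⟨B₂, h2, h2', e2⟩ := exists_amplitude_integral_mul_quadLogWave_eq h1 h1'
  obtain ⟨B₃, h3, -, e3⟩ := exists_amplitude_integral_mul_quadLogWave_eq h2 h2'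
  obtain ⟨C, hC⟩ := (isCompact_Icc.prod isCompact_Icc).exists_bound_of_continuousOn
    (s := Set.Icc (-2 : ℝ) 2 ×ˢ Set.Icc (0 : ℝ) 1) h3.continuous.continuousOn
  refine ⟨C, fun M l hl hM => ?_⟩
  obtain ⟨h, rfl⟩ : ∃ h, M = h * l := ⟨M / l, by field_simp⟩
  have hh : |h| ≤ 2 := by
    rw [abs_mul] at hM
    exact le_of_mul_le_mul_right hM (abs_pos.2 hl)
  have e1' := e1 h l hh
  have e2' := e2 h l hh
  have e3' := e3 h l hh
  rw [show (2 * |l|) ^ 3 * ‖∫ x in (0 : ℝ)..1, b x * quadLogWave (h * l) l x‖ = 2 * |l| * (2 * |l| *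
    (2 * |l| * ‖∫ x in (0 : ℝ)..1, b x * quadLogWave (h * l) l x‖)) by ring, e1', e2', e3']
  refine (intervalIntegral.norm_integral_le_of_norm_le_const (C := C) fun x hx => ?_).trans_eq ?_
  · rw [Set.uIoc_of_le zero_le_one] at hx
    rw [norm_mul, norm_quadLogWave, mul_one]
    exact hC _ ⟨abs_le.1 hh, hx.1.le, hx.2⟩
  · simp

/-- Change of variables `(u, v) = (x - y, x + y)` in a double integral. -/
lemma integral_comp_sub_mul_comp_add (F G : ℝ → ℂ) :
    ∫ p : ℝ × ℝ, F (p.1 - p.2) * G (p.1 + p.2) = 1 / 2 * ((∫ u, F u) * ∫ v, G v) := by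
  let f : (ℝ × ℝ) →ₗ[ℝ] (ℝ × ℝ) :=
    (LinearMap.fst ℝ ℝ ℝ - LinearMap.snd ℝ ℝ ℝ).prod (LinearMap.fst ℝ ℝ ℝ + LinearMap.snd ℝ ℝ ℝ)
  have hf : ∀ p, f p = (p.1 - p.2, p.1 + p.2) := fun p => rfl
  have hdet : LinearMap.det f = 2 := by
    rw [← LinearMap.det_toMatrix (Module.Basis.finTwoProd ℝ), Matrix.det_fin_two]
    simp [LinearMap.toMatrix_apply, hf]
    norm_num
  have hmap : Measure.map f (volume : Measure (ℝ × ℝ)) =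
      ENNReal.ofReal |(LinearMap.det f)⁻¹| • volume :=
    Measure.map_linearMap_addHaar_eq_smul_addHaar volume (by rw [hdet]; norm_num)
  have hinj : Function.Injective f := by
    intro p q h
    rw [hf, hf, Prod.mk.injEq] at h
    ext <;> linarith [h.1, h.2]
  have hemb : MeasurableEmbedding f :=
    (LinearMap.isClosedEmbedding_of_injective (LinearMap.ker_eq_bot.2 hinj)).measurableEmbedding
  have h1 := hemb.integral_map (μ := volume) (fun z : ℝ × ℝ => F z.1 * G z.2)
  rw [hmap, integral_smul_measure, Measure.volume_eq_prod, integral_prod_mul, hdet] at h1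
  simp only [hf] at h1
  rw [Measure.volume_eq_prod, ← h1]
  norm_num

lemma integral_mul_comp_mul_left (G : ℝ → ℂ) {T : ℝ} (hT : 0 < T) :
    ∫ u : ℝ, (T : ℂ) * G (T * u) = ∫ v, G v := by
  rw [integral_const_mul, Measure.integral_comp_mul_left, abs_of_pos (inv_pos.2 hT),
    Complex.real_smul, ← mul_assoc, ← Complex.ofReal_mul, mul_inv_cancel₀ hT.ne',
    Complex.ofReal_one, one_mul]

section Autocorrelation

variable {χ ψ : ℝ → ℂ}

lemma autocorrelation_eq_convolution
    (hψ : ∀ x : ℝ, ψ x = ∫ y : ℝ, χ y * (starRingEnd ℂ) (χ (y - x))) :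
    ψ = convolution χ (fun x => (starRingEnd ℂ) (χ (-x))) (ContinuousLinearMap.mul ℝ ℂ)
      volume := by
  ext x
  simp [hψ, convolution_def]

lemma contDiff_autocorrelation (hχ : ContDiff ℝ (⊤ : ℕ∞) χ) (hχc : HasCompactSupport χ)
    (hψ : ∀ x : ℝ, ψ x = ∫ y : ℝ, χ y * (starRingEnd ℂ) (χ (y - x))) :
    ContDiff ℝ (⊤ : ℕ∞) ψ := by
  rw [autocorrelation_eq_convolution hψ]
  refine HasCompactSupport.contDiff_convolution_right _ ?_
    (hχ.continuous.integrable_of_hasCompactSupport hχc).locallyIntegrable ?_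
  · exact (hχc.comp_homeomorph (Homeomorph.neg ℝ)).comp_left (map_zero _)
  · exact Complex.conjCLE.contDiff.comp (hχ.comp contDiff_neg)

lemma autocorrelation_eq_zero {R : ℝ} (hsupp : Function.support χ ⊆ Set.Icc (-R) R)
    (hψ : ∀ x : ℝ, ψ x = ∫ y : ℝ, χ y * (starRingEnd ℂ) (χ (y - x))) {x : ℝ}
    (hx : 2 * R < |x|) : ψ x = 0 := by
  rw [hψ]
  refine integral_eq_zero_of_ae (Filter.Eventually.of_forall fun y => ?_)
  by_contra h
  obtain ⟨h1, h2⟩ := mul_ne_zero_iff.1 h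
  have h3 := hsupp h1
  have h4 := hsupp ((map_ne_zero _).1 h2)
  rcases lt_abs.1 hx with h | h <;> linarith [h3.1, h3.2, h4.1, h4.2]

lemma fourier_autocorrelation (hχ : Continuous χ) (hχc : HasCompactSupport χ)
    (hψ : ∀ x : ℝ, ψ x = ∫ y : ℝ, χ y * (starRingEnd ℂ) (χ (y - x))) (ξ : ℝ) :
    ∫ x : ℝ, ψ x * Complex.exp (-Complex.I * ξ * x) =
      ((‖∫ x : ℝ, χ x * Complex.exp (-Complex.I * ξ * x)‖ ^ 2 : ℝ) : ℂ) := by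
  set f : ℝ → ℂ := fun x => χ x * Complex.exp (-Complex.I * ξ * x) with hf
  have hfc : Continuous f := by fun_prop
  have hfi : Integrable f := hfc.integrable_of_hasCompactSupport hχc.mul_right
  have hgi : Integrable fun x => (starRingEnd ℂ) (f (-x)) :=
    (Complex.conjCLE.toContinuousLinearMap.integrable_comp hfi).comp_neg
  have h1 := integral_convolution (ContinuousLinearMap.mul ℝ ℂ) hfi hgi
  have h2 : ∫ x, (starRingEnd ℂ) (f (-x)) = (starRingEnd ℂ) (∫ x, f x) := by
    rw [integral_neg_eq_self (fun x => (starRingEnd ℂ) (f x)) volume, integral_conj]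
  rw [h2, ContinuousLinearMap.mul_apply', Complex.mul_conj, Complex.normSq_eq_norm_sq] at h1
  rw [← h1]
  refine integral_congr_ae (Filter.Eventually.of_forall fun x => ?_)
  simp only [convolution_def, ContinuousLinearMap.mul_apply', hψ, hf, map_mul, ← Complex.exp_conj,
    ← integral_mul_const]
  refine integral_congr_ae (Filter.Eventually.of_forall fun y => ?_)
  simp only [neg_sub, map_neg, Complex.conj_I, Complex.conj_ofReal, neg_neg]
  have h3 : Complex.exp (-Complex.I * ξ * x) =
      Complex.exp (-Complex.I * ξ * y) * Complex.exp (Complex.I * ξ * ((y - x : ℝ) : ℂ)) := by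
    rw [← Complex.exp_add]
    push_cast
    ring_nf
  rw [h3]
  ring

end Autocorrelation

/-- The substitution `v = x²` in a half-line Mellin-type integral. -/
lemma integrableOn_and_norm_integral_Ioi_rpowC {φ : ℝ → ℂ} (hφ : Continuous φ)
    (hφ0 : ∀ v, 1 / 4 < v → φ v = 0) {T : ℝ} (hT : 0 < T) (M : ℝ) {s : ℂ} (hs : s.re = 0) :
    IntegrableOn (fun v : ℝ => Complex.exp (Complex.I * M * v) * φ v *
      rpowC (|v| / T) ((-s - 1) / 2)) (Set.Ioi 0) ∧
    ‖∫ v : ℝ in Set.Ioi 0, Complex.exp (Complex.I * M * v) * φ v *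
      rpowC (|v| / T) ((-s - 1) / 2)‖ =
      2 * √T * ‖∫ x in (0 : ℝ)..1, φ (x ^ 2) * quadLogWave M (s.im / 2) x‖ := by
  set g : ℝ → ℂ := fun v => Complex.exp (Complex.I * M * v) * φ v *
      rpowC (|v| / T) ((-s - 1) / 2) with hg
  set K : ℂ := 2 * Complex.exp (-((-s - 1) / 2) * Real.log T) with hK
  have hs' : s = s.im * Complex.I := by
    apply Complex.ext <;> simp [hs]
  have hKn : ‖K‖ = 2 * √T := by
    have h1 : (-((-s - 1) / 2) * (Real.log T : ℂ)).re = Real.log T * (1 / 2) := by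
      rw [hs', Complex.re_mul_ofReal]
      simp
      ring
    rw [hK, norm_mul, Complex.norm_exp, h1, ← Real.rpow_def_of_pos hT, ← Real.sqrt_eq_rpow]
    simp
  have hpt : ∀ x ∈ Set.Ioi (0 : ℝ), (|(2 : ℝ)| * x ^ ((2 : ℝ) - 1)) • g (x ^ (2 : ℝ)) =
      K * (φ (x ^ 2) * quadLogWave M (s.im / 2) x) := by
    intro x hx
    have hx0 : 0 < x := hx
    have hlog : Real.log (|x ^ 2| / T) = 2 * Real.log x - Real.log T := by
      rw [abs_of_pos (by positivity), Real.log_div (by positivity) hT.ne', Real.log_pow]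
      simp
    have hexp : (x : ℂ) = Complex.exp (Real.log x) := by
      rw [← Complex.ofReal_exp, Real.exp_log hx0]
    have hexps : (x : ℂ) * (Complex.exp (Complex.I * M * ((x ^ 2 : ℝ) : ℂ)) *
        Complex.exp ((-s - 1) / 2 * ((2 * Real.log x - Real.log T : ℝ) : ℂ))) =
        Complex.exp (-((-s - 1) / 2) * Real.log T) *
          Complex.exp (((M * x ^ 2 - 2 * (s.im / 2) * Real.log x : ℝ) : ℂ) * Complex.I) := by
      nth_rewrite 1 [hexp]
      rw [← Complex.exp_add, ← Complex.exp_add, ← Complex.exp_add]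
      congr 1
      push_cast
      linear_combination (-Real.log x : ℂ) * hs'
    rw [show (2 : ℝ) - 1 = 1 by norm_num, Real.rpow_one, Real.rpow_two, abs_two, Complex.real_smul]
    simp only [hg, rpowC, quadLogWave, hlog, hK]
    rw [Complex.ofReal_mul, Complex.ofReal_ofNat]
    linear_combination (2 * φ (x ^ 2)) * hexps
  have hzero : ∀ x ∈ Set.Ioi (0 : ℝ) \ Set.Ioc 0 1,
      K * (φ (x ^ 2) * quadLogWave M (s.im / 2) x) = 0 := by
    intro x hx
    have hx1 : 1 < x := by
      by_contra h
      exact hx.2 ⟨hx.1, not_lt.1 h⟩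
    rw [hφ0 _ (by nlinarith), zero_mul, mul_zero]
  have hint : IntegrableOn (fun x => K * (φ (x ^ 2) * quadLogWave M (s.im / 2) x))
      (Set.Ioc 0 1) :=
    (intervalIntegrable_mul_quadLogWave (hφ.comp (continuous_pow 2)) M
      (s.im / 2) 0 1).1.const_mul K
  constructor
  · rw [← integrableOn_Ioi_comp_rpow_iff g (two_ne_zero : (2 : ℝ) ≠ 0),
      integrableOn_congr_fun hpt measurableSet_Ioi]
    exact hint.of_forall_sdiff_eq_zero measurableSet_Ioi hzero
  · rw [← integral_comp_rpow_Ioi g (two_ne_zero : (2 : ℝ) ≠ 0),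
      setIntegral_congr_fun measurableSet_Ioi hpt,
      setIntegral_eq_of_subset_of_forall_sdiff_eq_zero measurableSet_Ioi Set.Ioc_subset_Ioi_self
        hzero, integral_const_mul, norm_mul, hKn, intervalIntegral.integral_of_le zero_le_one]

lemma norm_integral_exp_mul_rpowC_le {ψ : ℝ → ℂ} (hψ : Continuous ψ)
    (hψ0 : ∀ v, 1 / 4 < |v| → ψ v = 0) {T : ℝ} (hT : 0 < T) (N : ℝ) {s : ℂ} (hs : s.re = 0) :
    ‖∫ u : ℝ, T * Complex.exp (Complex.I * N * u) * ψ (T * u) * rpowC |u| ((-s - 1) / 2)‖ ≤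
      2 * √T * (‖∫ x in (0 : ℝ)..1, ψ (x ^ 2) * quadLogWave (N / T) (s.im / 2) x‖ +
        ‖∫ x in (0 : ℝ)..1, ψ (-x ^ 2) * quadLogWave (-(N / T)) (s.im / 2) x‖) := by
  set G : ℝ → ℂ := fun v => Complex.exp (Complex.I * (N / T : ℝ) * v) * ψ v *
    rpowC (|v| / T) ((-s - 1) / 2) with hG
  obtain ⟨i1, e1⟩ := integrableOn_and_norm_integral_Ioi_rpowC hψ
    (fun v hv => hψ0 v (hv.trans_le (le_abs_self v))) hT (N / T) hs
  obtain ⟨i2, e2⟩ := integrableOn_and_norm_integral_Ioi_rpowC (φ := fun v => ψ (-v))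
    (hψ.comp continuous_neg)
    (fun v hv => hψ0 (-v) (by rw [abs_neg]; exact hv.trans_le (le_abs_self v))) hT (-(N / T)) hs
  have hGneg : (fun v : ℝ => Complex.exp (Complex.I * (-(N / T) : ℝ) * v) * ψ (-v) *
      rpowC (|v| / T) ((-s - 1) / 2)) = fun v => G (-v) := by
    ext v
    simp [hG]
  have hf : ∀ u : ℝ, T * Complex.exp (Complex.I * N * u) * ψ (T * u) *
      rpowC |u| ((-s - 1) / 2) = T * G (T * u) := by
    intro u
    have h1 : |T * u| / T = |u| := by
      rw [abs_mul, abs_of_pos hT]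
      field_simp
    have h2 : Complex.I * ((N / T : ℝ) : ℂ) * ((T * u : ℝ) : ℂ) = Complex.I * N * u := by
      have : (T : ℂ) ≠ 0 := by exact_mod_cast hT.ne'
      push_cast
      field_simp
    simp only [hG, h1, h2]
    ring
  rw [hGneg] at i2
  simp only [congrFun hGneg] at e2
  have i2' : IntegrableOn G (Set.Iic 0) := by
    rw [integrableOn_Iic_iff_integrableOn_Iio]
    simpa using i2.comp_neg
  simp only [hf]
  rw [integral_mul_comp_mul_left G hT, ← intervalIntegral.integral_Iic_add_Ioi i2' i1, mul_add, ← e1, ← e2,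
    integral_comp_neg_Ioi, neg_zero, add_comm]
  exact norm_add_le _ _

lemma integral_exp_mul_comp_mul_exp (ψ : ℝ → ℂ) {T : ℝ} (hT : 0 < T) (N ξ : ℝ) :
    ∫ u : ℝ, T * Complex.exp (Complex.I * N * u) * ψ (T * u) * Complex.exp (-Complex.I * ξ * u) =
      ∫ v : ℝ, ψ v * Complex.exp (-Complex.I * ((ξ - N) / T : ℝ) * v) := by
  let G : ℝ → ℂ := fun v => ψ v * Complex.exp (-Complex.I * ((ξ - N) / T : ℝ) * v)
  have h : ∀ u : ℝ, T * Complex.exp (Complex.I * N * u) * ψ (T * u) *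
      Complex.exp (-Complex.I * ξ * u) = T * G (T * u) := by
    intro u
    have h1 : -Complex.I * (((ξ - N) / T : ℝ) : ℂ) * ((T * u : ℝ) : ℂ) =
        Complex.I * N * u + -Complex.I * ξ * u := by
      have : (T : ℂ) ≠ 0 := by exact_mod_cast hT.ne'
      push_cast
      field_simp
      ring
    simp only [G, h1, Complex.exp_add]
    ring
  exact (integral_congr_ae (Filter.Eventually.of_forall h)).trans (integral_mul_comp_mul_left G hT)

/-- Both uniform bounds for the oscillatory integral with a fixed amplitude. -/
lemma exists_norm_integral_mul_quadLogWave_le {b : ℝ → ℂ} (hb : ContDiff ℝ (⊤ : ℕ∞) b)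
    (hb0 : ∀ x : ℝ, 1 / 2 < x → b x = 0) :
    ∃ C : ℝ, 0 ≤ C ∧ ∀ M l : ℝ, 1 ≤ |M| →
      ‖∫ x in (0 : ℝ)..1, b x * quadLogWave M l x‖ ≤ C * |M| ^ (-(1 : ℝ) / 2) ∧
      (|M| ≤ 2 * |l| →
        ‖∫ x in (0 : ℝ)..1, b x * quadLogWave M l x‖ ≤ C * (1 + 2 * |l|) ^ (-(3 : ℝ))) := by
  have hb1 : ContDiff ℝ 1 b := hb.of_le (by exact_mod_cast le_top)
  obtain ⟨C₁, h1⟩ := isCompact_Icc.exists_bound_of_continuousOn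
    (s := Set.Icc (0 : ℝ) 1) hb.continuous.continuousOn
  obtain ⟨C₂, h2⟩ := isCompact_Icc.exists_bound_of_continuousOn
    (s := Set.Icc (0 : ℝ) 1) (hb1.continuous_deriv le_rfl).continuousOn
  obtain ⟨C₃, h3⟩ := exists_norm_integral_mul_quadLogWave_le_inv_pow hb hb0
  have hC₁ : 0 ≤ C₁ := (norm_nonneg _).trans (h1 0 (by simp))
  have hC₃ : 0 ≤ C₃ := le_trans (by positivity) (h3 1 1 one_ne_zero (by norm_num))
  refine ⟨7 * max C₁ C₂ + 8 * C₃, by positivity, fun M l hM => ⟨?_, fun hMl => ?_⟩⟩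
  · refine (norm_integral_mul_quadLogWave_le hb1 (fun x hx => (h1 x hx).trans (le_max_left _ C₂))
      (fun x hx => (h2 x hx).trans (le_max_right C₁ _)) hM l).trans ?_
    gcongr
    linarith
  · set t := 2 * |l| with ht
    have ht1 : 1 ≤ t := hM.trans hMl
    have hl : l ≠ 0 := abs_pos.1 (by linarith)
    have h := h3 M l hl hMl
    rw [← ht] at h
    rw [Real.rpow_neg (by linarith), show (3 : ℝ) = ((3 : ℕ) : ℝ) by norm_num, Real.rpow_natCast,
      ← div_eq_mul_inv, le_div_iff₀ (by positivity)]
    have hpow : (1 + t) ^ 3 ≤ 8 * t ^ 3 := by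
      calc (1 + t) ^ 3 ≤ (2 * t) ^ 3 := by gcongr; linarith
        _ = 8 * t ^ 3 := by ring
    have := mul_le_mul_of_nonneg_left hpow
      (norm_nonneg (∫ x in (0 : ℝ)..1, b x * quadLogWave M l x))
    have : 0 ≤ max C₁ C₂ := hC₁.trans (le_max_left _ _)
    linarith

/-- Lemma 3.2 of the paper: the key properties of the test functions `w_{N,T}`. -/
theorem test_vector_bounds
    (χ : ℝ → ℂ) (hχ_smooth : ContDiff ℝ (⊤ : ℕ∞) χ)
    (hχ_supp : Function.support χ ⊆ Set.Icc (-(1 / 8) : ℝ) (1 / 8))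
    (hχ_fourier : ∀ ξ : ℝ, |ξ| ≤ 1 →
      1 ≤ ‖∫ x : ℝ, χ x * Complex.exp (-Complex.I * (ξ : ℂ) * (x : ℂ))‖)
    (ψ : ℝ → ℂ)
    (hψ : ∀ x : ℝ, ψ x = ∫ y : ℝ, χ y * (starRingEnd ℂ) (χ (y - x)))
    (w : ℝ → ℝ → ℝ × ℝ → ℂ)
    (hw : ∀ N T : ℝ, ∀ p : ℝ × ℝ, w N T p =
      (T : ℂ) * Complex.exp (Complex.I * (N : ℂ) * ((p.1 : ℂ) - (p.2 : ℂ))) *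
        ψ (T * (p.1 - p.2)) * ψ (p.1 + p.2)) :
    ∃ c : ℝ, 0 < c ∧ ∀ N T : ℝ, 1 ≤ T → T ≤ N →
      -- (1) bound on the diagonal integral
      (‖∫ t : ℝ, w N T (t, t)‖ ≤ c * T) ∧
      -- (2) ŵ_{N,T} is real and nonnegative
      (∀ ξ : ℝ, (fourierW (w N T) ξ).im = 0 ∧ 0 ≤ (fourierW (w N T) ξ).re) ∧
      -- (3) ŵ_{N,T}(ξ) ≥ 1/2 for |ξ − N| ≤ T
      (∀ ξ : ℝ, |ξ - N| ≤ T → 1 / 2 ≤ (fourierW (w N T) ξ).re) ∧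
      -- (4) bound in the range |s| ≤ N/T
      (∀ s : ℂ, s.re = 0 → ‖s‖ ≤ N / T →
        ‖flatW (w N T) s‖ ≤ c * T * N ^ (-(1 : ℝ) / 2)) ∧
      -- (5) bound in the range |s| ≥ N/T
      (∀ s : ℂ, s.re = 0 → N / T ≤ ‖s‖ →
        ‖flatW (w N T) s‖ ≤ c * T * (1 + ‖s‖) ^ (-(3 : ℝ))) := by
  have hχc : HasCompactSupport χ := HasCompactSupport.of_support_subset_isCompact isCompact_Icc
    hχ_supp
  have hψs : ContDiff ℝ (⊤ : ℕ∞) ψ := contDiff_autocorrelation hχ_smooth hχc hψ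
  have hψ0 : ∀ v, 1 / 4 < |v| → ψ v = 0 := fun v hv =>
    autocorrelation_eq_zero hχ_supp hψ (by linarith)
  have hψF := fourier_autocorrelation hχ_smooth.continuous hχc hψ
  have hψint : ∫ v, ψ v =
      ((‖∫ x : ℝ, χ x * Complex.exp (-Complex.I * (0 : ℝ) * x)‖ ^ 2 : ℝ) : ℂ) := by
    simpa using hψF 0
  have hpos : ∀ x : ℝ, 1 / 2 < x → 1 / 4 < |x ^ 2| := fun x hx => by
    rw [abs_of_nonneg (sq_nonneg x)]
    nlinarith
  obtain ⟨C₁, hC₁, h₁⟩ := exists_norm_integral_mul_quadLogWave_le (b := fun x => ψ (x ^ 2))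
    (hψs.comp (contDiff_id.pow 2)) (fun x hx => hψ0 _ (hpos x hx))
  obtain ⟨C₂, hC₂, h₂⟩ := exists_norm_integral_mul_quadLogWave_le (b := fun x => ψ (-x ^ 2))
    (hψs.comp (contDiff_id.pow 2).neg) (fun x hx => hψ0 _ (by rw [abs_neg]; exact hpos x hx))
  set A := ‖∫ v, ψ v‖ with hA
  have hA0 : 0 ≤ A := norm_nonneg _
  set D := ‖ψ 0‖ * ‖∫ t : ℝ, ψ (2 * t)‖ with hD
  have hD0 : 0 ≤ D := by positivity
  have hAC : 0 ≤ A * (C₁ + C₂) := by positivity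
  refine ⟨D + A * (C₁ + C₂) + 1, by positivity, fun N T hT hTN => ?_⟩
  have hT0 : 0 < T := by linarith
  have hN0 : 0 < N := by linarith
  have hM1 : 1 ≤ N / T := (one_le_div hT0).2 hTN
  have hMabs : |N / T| = N / T := abs_of_nonneg (by linarith)
  have hfour : ∀ ξ : ℝ, fourierW (w N T) ξ = ((1 / 2 *
      (‖∫ x : ℝ, χ x * Complex.exp (-Complex.I * ((ξ - N) / T : ℝ) * x)‖ ^ 2 *
      ‖∫ x : ℝ, χ x * Complex.exp (-Complex.I * (0 : ℝ) * x)‖ ^ 2) : ℝ) : ℂ) := by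
    intro ξ
    have h := integral_comp_sub_mul_comp_add (fun u => T * Complex.exp (Complex.I * N * u) *
      ψ (T * u) * Complex.exp (-Complex.I * ξ * u)) ψ
    rw [integral_exp_mul_comp_mul_exp ψ hT0, hψF, hψint] at h
    rw [fourierW, Complex.ofReal_mul, Complex.ofReal_mul]
    push_cast at h ⊢
    rw [← h]
    refine integral_congr_ae (Filter.Eventually.of_forall fun p => ?_)
    simp only [hw]
    ring
  have hflat : ∀ s : ℂ, s.re = 0 → ‖flatW (w N T) s‖ ≤ A * √T *
      (‖∫ x in (0 : ℝ)..1, ψ (x ^ 2) * quadLogWave (N / T) (s.im / 2) x‖ +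
        ‖∫ x in (0 : ℝ)..1, ψ (-x ^ 2) * quadLogWave (-(N / T)) (s.im / 2) x‖) := by
    intro s hs
    have h := integral_comp_sub_mul_comp_add (fun u => T * Complex.exp (Complex.I * N * u) *
      ψ (T * u) * rpowC |u| ((-s - 1) / 2)) ψ
    have h' : flatW (w N T) s = 1 / 2 * ((∫ u : ℝ, T * Complex.exp (Complex.I * N * u) *
      ψ (T * u) * rpowC |u| ((-s - 1) / 2)) * ∫ v, ψ v) := by
      rw [← h, flatW]
      refine integral_congr_ae (Filter.Eventually.of_forall fun p => ?_)
      simp only [hw]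
      push_cast
      ring
    have h2 := norm_integral_exp_mul_rpowC_le hψs.continuous hψ0 hT0 N hs
    rw [h', norm_mul, norm_mul, ← hA]
    have h3 := mul_le_mul_of_nonneg_left h2 hA0
    norm_num
    linarith
  have him : ∀ s : ℂ, s.re = 0 → 2 * |s.im / 2| = ‖s‖ := by
    intro s hs
    rw [← Complex.abs_im_eq_norm.2 hs, abs_div, abs_two]
    ring
  refine ⟨?_, fun ξ => ?_, fun ξ hξ => ?_, fun s hs _ => ?_, fun s hs hsM => ?_⟩
  · have h : ∀ t : ℝ, w N T (t, t) = T * ψ 0 * ψ (2 * t) := fun t => by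
      simp [hw, two_mul]
    simp only [h]
    rw [integral_const_mul, norm_mul, norm_mul, Complex.norm_real, Real.norm_of_nonneg hT0.le]
    have : 0 ≤ (A * (C₁ + C₂) + 1) * T := by positivity
    linarith
  · rw [hfour]
    exact ⟨Complex.ofReal_im _, by rw [Complex.ofReal_re]; positivity⟩
  · rw [hfour, Complex.ofReal_re]
    have h1 := hχ_fourier ((ξ - N) / T) (by
      rw [abs_div, abs_of_pos hT0]
      exact (div_le_one hT0).2 hξ)
    have h2 := hχ_fourier 0 (by simp)
    have h3 := one_le_mul_of_one_le_of_one_le (one_le_pow₀ h1 (n := 2)) (one_le_pow₀ h2 (n := 2))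
    linarith
  · have g₁ := (h₁ (N / T) (s.im / 2) (by rwa [hMabs])).1
    have g₂ := (h₂ (-(N / T)) (s.im / 2) (by rwa [abs_neg, hMabs])).1
    rw [abs_neg] at g₂
    rw [hMabs] at g₁ g₂
    have hpow : √T * (N / T) ^ (-(1 : ℝ) / 2) = T * N ^ (-(1 : ℝ) / 2) := by
      rw [Real.div_rpow hN0.le hT0.le, Real.sqrt_eq_rpow, mul_div_left_comm,
        ← Real.rpow_sub hT0, mul_comm]
      norm_num
    calc _ ≤ A * √T * (C₁ * (N / T) ^ (-(1 : ℝ) / 2) + C₂ * (N / T) ^ (-(1 : ℝ) / 2)) :=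
          (hflat s hs).trans (by gcongr)
      _ = A * (C₁ + C₂) * (√T * (N / T) ^ (-(1 : ℝ) / 2)) := by ring
      _ = A * (C₁ + C₂) * T * N ^ (-(1 : ℝ) / 2) := by rw [hpow]; ring
      _ ≤ _ := by
        gcongr
        linarith
  · have g₁ := (h₁ (N / T) (s.im / 2) (by rwa [hMabs])).2 (by rwa [him s hs, hMabs])
    have g₂ := (h₂ (-(N / T)) (s.im / 2) (by rwa [abs_neg, hMabs])).2
      (by rwa [him s hs, abs_neg, hMabs])
    rw [him s hs] at g₁ g₂
    have hsqrt : √T ≤ T := by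
      rw [Real.sqrt_le_left hT0.le]
      nlinarith
    calc _ ≤ A * √T * (C₁ * (1 + ‖s‖) ^ (-(3 : ℝ)) + C₂ * (1 + ‖s‖) ^ (-(3 : ℝ))) :=
          (hflat s hs).trans (by gcongr)
      _ = A * (C₁ + C₂) * √T * (1 + ‖s‖) ^ (-(3 : ℝ)) := by ring
      _ ≤ _ := by
        gcongr
        linarith
end

section
/- (Lemma 3.3 of the paper.) Let ψ: ℝ → ℂ be a smooth function with compact support contained in [-1, 1]. For purely imaginary s ∈ ℂ and ξ ∈ ℝ define ψ^♭(ξ, s) = ∫_ℝ ψ(t)·e^{−iξt}·|t|^{−1/2 − s} dt (the integral converges absolutely since Re(−1/2 − s) = −1/2 > −1; here r^z := exp(z·log r) for r > 0). Then there exists a constant c > 0, depending only on ψ, such that: (1) |ψ^♭(ξ, s)| ≤ c·(1+|ξ|)^{−1/2} for all purely imaginary s and real ξ with |s| ≤ 2|ξ|; and (2) |ψ^♭(ξ, s)| ≤ c·(1+|s|)^{−3} for all purely imaginary s and real ξ with |s| ≥ 2|ξ|. -/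
open MeasureTheory

/-- The transform `ψ^♭(ξ, s) = ∫_ℝ ψ(t)·e^{−iξt}·|t|^{−1/2 − s} dt`. -/
noncomputable def psiFlat (ψ : ℝ → ℂ) (ξ : ℝ) (s : ℂ) : ℂ :=
  ∫ t : ℝ, ψ t * Complex.exp (-Complex.I * (ξ : ℂ) * (t : ℂ)) * rpowC |t| (-(1 / 2) - s)

/-- The oscillating factor `exp(-i(ξ r² + 2σ log r))` obtained from `e^{-iξt}|t|^{-iσ}` at `t = r²`. -/
noncomputable def osc (ξ σ r : ℝ) : ℂ :=
  Complex.exp (((-(ξ * r ^ 2 + 2 * σ * Real.log r) : ℝ) : ℂ) * Complex.I)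

lemma norm_osc (ξ σ r : ℝ) : ‖osc ξ σ r‖ = 1 := Complex.norm_exp_ofReal_mul_I _

lemma measurable_osc (ξ σ : ℝ) : Measurable (osc ξ σ) := by
  unfold osc
  fun_prop

lemma hasDerivAt_osc (ξ σ : ℝ) {r : ℝ} (hr : 0 < r) :
    HasDerivAt (osc ξ σ)
      (((-(2 * ξ * r + 2 * σ / r) : ℝ) : ℂ) * Complex.I * osc ξ σ r) r := by
  have h1 : HasDerivAt (fun r : ℝ => -(ξ * r ^ 2 + 2 * σ * Real.log r))
      (-(2 * ξ * r + 2 * σ / r)) r := by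
    have := (((hasDerivAt_id r).pow 2).const_mul ξ).add
      ((Real.hasDerivAt_log hr.ne').const_mul (2 * σ))
    refine this.neg.congr_deriv ?_
    simp only [id, Nat.cast_ofNat]
    ring
  have h2 := (h1.ofReal_comp.mul_const Complex.I).cexp
  exact h2.congr_deriv (mul_comm (Complex.exp _) _)

lemma continuousAt_osc (ξ σ : ℝ) {r : ℝ} (hr : 0 < r) : ContinuousAt (osc ξ σ) r :=
  (hasDerivAt_osc ξ σ hr).continuousAt

lemma intervalIntegrable_mul_osc {f : ℝ → ℂ} {a b : ℝ} (hf : ContinuousOn f (Set.uIcc a b))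
    (ξ σ : ℝ) : IntervalIntegrable (fun r => f r * osc ξ σ r) volume a b := by
  refine hf.intervalIntegrable.mono_fun ?_
    (Filter.Eventually.of_forall fun r => by simp [norm_osc])
  exact hf.intervalIntegrable.def'.aestronglyMeasurable.mul
    (measurable_osc ξ σ).aestronglyMeasurable

lemma intervalIntegrable_osc (ξ σ a b : ℝ) : IntervalIntegrable (osc ξ σ) volume a b := by
  simpa using intervalIntegrable_mul_osc (f := fun _ => 1) (a := a) (b := b)
    continuousOn_const ξ σ

lemma norm_integral_osc_le (ξ σ : ℝ) {a b : ℝ} (hab : a ≤ b) :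
    ‖∫ r in a..b, osc ξ σ r‖ ≤ b - a := by
  have := intervalIntegral.norm_integral_le_of_norm_le_const (a := a) (b := b) (C := 1)
    (f := osc ξ σ) (fun r _ => (norm_osc ξ σ r).le)
  rwa [one_mul, abs_of_nonneg (sub_nonneg.2 hab)] at this

/-- The reciprocal of the derivative of the phase `ξ r² + 2σ log r`. -/
noncomputable def invPhaseDeriv (ξ σ r : ℝ) : ℝ := r / (2 * (ξ * r ^ 2 + σ))

lemma hasDerivAt_invPhaseDeriv {ξ σ r : ℝ} (h : ξ * r ^ 2 + σ ≠ 0) :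
    HasDerivAt (invPhaseDeriv ξ σ) ((σ - ξ * r ^ 2) / (2 * (ξ * r ^ 2 + σ) ^ 2)) r := by
  have h1 : HasDerivAt (fun r : ℝ => 2 * (ξ * r ^ 2 + σ)) (2 * (ξ * (2 * r))) r := by
    simpa using ((((hasDerivAt_id r).pow 2).const_mul ξ).add_const σ).const_mul 2
  refine ((hasDerivAt_id r).div h1 (by positivity)).congr_deriv ?_
  simp only [id]
  field_simp
  ring

/-- A van der Corput type estimate on an interval where the reciprocal of the phase derivative
is monotone. -/
lemma norm_integral_osc_le_of_monotone {ξ σ a b B : ℝ} (ha : 0 < a) (hab : a ≤ b)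
    (hne : ∀ r ∈ Set.Icc a b, ξ * r ^ 2 + σ ≠ 0)
    (hsign : (∀ r ∈ Set.Icc a b, 0 ≤ σ - ξ * r ^ 2) ∨ (∀ r ∈ Set.Icc a b, σ - ξ * r ^ 2 ≤ 0))
    (hA : |invPhaseDeriv ξ σ a| ≤ B) (hB : |invPhaseDeriv ξ σ b| ≤ B) :
    ‖∫ r in a..b, osc ξ σ r‖ ≤ 4 * B := by
  set h' : ℝ → ℝ := fun r => (σ - ξ * r ^ 2) / (2 * (ξ * r ^ 2 + σ) ^ 2)
  have hd : ∀ r ∈ Set.Icc a b, HasDerivAt (invPhaseDeriv ξ σ) (h' r) r :=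
    fun r hr => hasDerivAt_invPhaseDeriv (hne r hr)
  have hcont' : ContinuousOn h' (Set.Icc a b) := by
    apply ContinuousOn.div (by fun_prop) (by fun_prop)
    intro r hr
    have := hne r hr
    positivity
  have hint' : IntervalIntegrable h' volume a b :=
    ContinuousOn.intervalIntegrable (by rwa [Set.uIcc_of_le hab])
  have hFTC : ∫ r in a..b, h' r = invPhaseDeriv ξ σ b - invPhaseDeriv ξ σ a :=
    intervalIntegral.integral_eq_sub_of_hasDerivAt
      (fun r hr => hd r (by rwa [Set.uIcc_of_le hab] at hr)) hint'
  have habs : ∫ r in a..b, |h' r| ≤ 2 * B := by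
    rcases hsign with hs | hs
    · have : ∫ r in a..b, |h' r| = ∫ r in a..b, h' r := by
        apply intervalIntegral.integral_congr
        intro r hr
        rw [Set.uIcc_of_le hab] at hr
        exact abs_of_nonneg (div_nonneg (hs r hr) (by positivity))
      rw [this, hFTC]
      linarith [abs_le.1 hA, abs_le.1 hB]
    · have : ∫ r in a..b, |h' r| = ∫ r in a..b, - h' r := by
        apply intervalIntegral.integral_congr
        intro r hr
        rw [Set.uIcc_of_le hab] at hr
        exact abs_of_nonpos (div_nonpos_of_nonpos_of_nonneg (hs r hr) (by positivity))
      rw [this, intervalIntegral.integral_neg, hFTC]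
      linarith [abs_le.1 hA, abs_le.1 hB]
  have hcc : ContinuousOn (fun r => ((h' r : ℝ) : ℂ) * Complex.I) (Set.uIcc a b) := by
    rw [Set.uIcc_of_le hab]
    exact (Complex.continuous_ofReal.comp_continuousOn hcont').mul continuousOn_const
  have hi := intervalIntegrable_mul_osc hcc ξ σ
  have key : ∫ r in a..b, (((h' r : ℝ) : ℂ) * Complex.I * osc ξ σ r + osc ξ σ r) =
      ((invPhaseDeriv ξ σ b : ℝ) : ℂ) * Complex.I * osc ξ σ b -
        ((invPhaseDeriv ξ σ a : ℝ) : ℂ) * Complex.I * osc ξ σ a := by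
    refine intervalIntegral.integral_eq_sub_of_hasDerivAt
      (f := fun r => ((invPhaseDeriv ξ σ r : ℝ) : ℂ) * Complex.I * osc ξ σ r) ?_
      (hi.add (intervalIntegrable_osc ξ σ a b))
    intro r hr
    rw [Set.uIcc_of_le hab] at hr
    have hr0 : 0 < r := ha.trans_le hr.1
    have hner := hne r hr
    refine (((hd r hr).ofReal_comp.mul_const Complex.I).mul
      (hasDerivAt_osc ξ σ hr0)).congr_deriv ?_
    have hprod : invPhaseDeriv ξ σ r * (2 * ξ * r + 2 * σ / r) = 1 := by
      have hner' : r ^ 2 * ξ + σ ≠ 0 := by rwa [mul_comm]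
      unfold invPhaseDeriv
      field_simp
    have hprodC : ((invPhaseDeriv ξ σ r : ℝ) : ℂ) * ((2 * ξ * r + 2 * σ / r : ℝ) : ℂ) = 1 := by
      exact_mod_cast hprod
    rw [Complex.ofReal_neg]
    linear_combination (osc ξ σ r) * hprodC - ((invPhaseDeriv ξ σ r : ℝ) : ℂ) *
      ((2 * ξ * r + 2 * σ / r : ℝ) : ℂ) * osc ξ σ r * Complex.I_sq
  rw [intervalIntegral.integral_add hi (intervalIntegrable_osc ξ σ a b)] at key
  have hbound : ‖∫ r in a..b, ((h' r : ℝ) : ℂ) * Complex.I * osc ξ σ r‖ ≤ 2 * B := by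
    refine (intervalIntegral.norm_integral_le_integral_norm hab).trans (le_of_eq_of_le ?_ habs)
    simp [norm_osc]
  have hbdry : ∀ r, ‖((invPhaseDeriv ξ σ r : ℝ) : ℂ) * Complex.I * osc ξ σ r‖ =
      |invPhaseDeriv ξ σ r| := by
    intro r
    simp [norm_osc]
  rw [← eq_sub_iff_add_eq'] at key
  rw [key]
  calc _ ≤ ‖((invPhaseDeriv ξ σ b : ℝ) : ℂ) * Complex.I * osc ξ σ b‖ +
        ‖((invPhaseDeriv ξ σ a : ℝ) : ℂ) * Complex.I * osc ξ σ a‖ +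
        ‖∫ r in a..b, ((h' r : ℝ) : ℂ) * Complex.I * osc ξ σ r‖ :=
        norm_sub_le_of_le (norm_sub_le _ _) le_rfl
    _ ≤ B + B + 2 * B := by
        rw [hbdry, hbdry]
        gcongr
    _ = 4 * B := by ring

lemma norm_integral_osc_le_add {ξ σ a b c B C : ℝ}
    (h1 : ‖∫ r in a..b, osc ξ σ r‖ ≤ B) (h2 : ‖∫ r in b..c, osc ξ σ r‖ ≤ C) :
    ‖∫ r in a..c, osc ξ σ r‖ ≤ B + C := by
  rw [← intervalIntegral.integral_add_adjacent_intervals (intervalIntegrable_osc ξ σ a b)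
    (intervalIntegrable_osc ξ σ b c)]
  exact norm_add_le_of_le h1 h2

lemma norm_integral_osc_le_of_nonneg {ξ σ δ x : ℝ} (hξ : 0 < ξ) (hδ : 0 < δ)
    (hξδ : ξ * δ ^ 2 = 1) (hσ : 0 ≤ σ) (hx : δ ≤ x) :
    ‖∫ r in δ..x, osc ξ σ r‖ ≤ 4 * δ := by
  have hpos : ∀ r, δ ≤ r → 0 < ξ * r ^ 2 + σ := by
    intro r hr
    have : 0 < r := hδ.trans_le hr
    positivity
  have hinv : ∀ r, δ ≤ r → |invPhaseDeriv ξ σ r| ≤ δ / 2 := by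
    intro r hr
    have hr0 : 0 < r := hδ.trans_le hr
    have hp := hpos r hr
    unfold invPhaseDeriv
    rw [abs_of_pos (by positivity), div_le_iff₀ (by positivity)]
    have h1 : ξ * δ ^ 2 * r ≤ ξ * δ * r * r := by
      have := mul_le_mul_of_nonneg_left hr (by positivity : 0 ≤ ξ * δ * r)
      nlinarith
    have h2 : 0 ≤ δ * σ := by positivity
    rw [hξδ] at h1
    nlinarith
  set q := Real.sqrt (σ / ξ) with hq
  have hq0 : 0 ≤ q := Real.sqrt_nonneg _
  have hq2 : ξ * q ^ 2 = σ := by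
    rw [hq, Real.sq_sqrt (by positivity)]
    field_simp
  set p := max δ (min x q)
  have hδp : δ ≤ p := le_max_left _ _
  have hpx : p ≤ x := max_le hx (min_le_left _ _)
  have h1 : ‖∫ r in δ..p, osc ξ σ r‖ ≤ 2 * δ := by
    rcases hδp.eq_or_lt with h | h
    · rw [← h]
      simp [hδ.le]
    · have hpq : p ≤ q := by
        rcases le_max_iff.1 (le_refl p) with h' | h'
        · linarith
        · exact h'.trans (min_le_right _ _)
      refine (norm_integral_osc_le_of_monotone (B := δ / 2) hδ hδp
        (fun r hr => (hpos r hr.1).ne') (Or.inl fun r hr => ?_) (hinv _ le_rfl)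
        (hinv _ hδp)).trans (by linarith)
      have : r ^ 2 ≤ q ^ 2 := pow_le_pow_left₀ (hδ.le.trans hr.1) (hr.2.trans hpq) 2
      nlinarith
  have h2 : ‖∫ r in p..x, osc ξ σ r‖ ≤ 2 * δ := by
    rcases hpx.eq_or_lt with h | h
    · rw [← h]
      simp [hδ.le]
    · have hpq : q ≤ p := by
        by_contra! hc
        have : min x q ≤ p := le_max_right _ _
        rcases min_le_iff.1 this with h' | h' <;> linarith
      refine (norm_integral_osc_le_of_monotone (B := δ / 2) (hδ.trans_le hδp) hpx
        (fun r hr => (hpos r (hδp.trans hr.1)).ne') (Or.inr fun r hr => ?_) (hinv _ hδp)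
        (hinv _ hx)).trans (by linarith)
      have : q ^ 2 ≤ r ^ 2 := pow_le_pow_left₀ hq0 (hpq.trans hr.1) 2
      nlinarith
  exact (norm_integral_osc_le_add h1 h2).trans (by linarith)

lemma norm_integral_osc_le_of_neg {ξ σ δ x : ℝ} (hξ : 0 < ξ) (hδ : 0 < δ)
    (hξδ : ξ * δ ^ 2 = 1) (hσ : σ < 0) (hx : δ ≤ x) :
    ‖∫ r in δ..x, osc ξ σ r‖ ≤ 6 * δ := by
  set q := Real.sqrt (-σ / ξ) with hq
  have hσ' : 0 < -σ := by linarith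
  have hq0 : 0 < q := Real.sqrt_pos.2 (by positivity)
  have hq2 : ξ * q ^ 2 = -σ := by
    rw [hq, Real.sq_sqrt (by positivity)]
    field_simp
  have hfac : ∀ r, ξ * r ^ 2 + σ = ξ * ((r - q) * (r + q)) := by
    intro r
    linear_combination hq2
  have habs : ∀ r, δ ≤ r → δ ≤ |r - q| → ξ * δ * (r + q) ≤ |ξ * r ^ 2 + σ| := by
    intro r hr hrq
    have hr0 : 0 < r := hδ.trans_le hr
    rw [hfac, abs_mul, abs_mul, abs_of_pos hξ, abs_of_pos (by positivity : 0 < r + q), mul_assoc]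
    gcongr
  have hne : ∀ r, δ ≤ r → δ ≤ |r - q| → ξ * r ^ 2 + σ ≠ 0 := by
    intro r hr hrq
    have hr0 : 0 < r := hδ.trans_le hr
    exact abs_pos.1 (lt_of_lt_of_le (by positivity) (habs r hr hrq))
  have hinv : ∀ r, δ ≤ r → δ ≤ |r - q| → |invPhaseDeriv ξ σ r| ≤ δ / 2 := by
    intro r hr hrq
    have hr0 : 0 < r := hδ.trans_le hr
    have h1 := habs r hr hrq
    have h2 := abs_pos.2 (hne r hr hrq)
    unfold invPhaseDeriv
    rw [abs_div, abs_mul, abs_of_pos hr0, abs_of_pos (two_pos : (0 : ℝ) < 2),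
      div_le_iff₀ (by positivity)]
    have h3 := mul_le_mul_of_nonneg_left h1 hδ.le
    have h4 : δ * (ξ * δ * (r + q)) = r + q := by linear_combination (r + q) * hξδ
    linarith
  have hsgn : ∀ r : ℝ, σ - ξ * r ^ 2 ≤ 0 := fun r => by
    have : 0 ≤ ξ * r ^ 2 := by positivity
    linarith
  set p := max δ (min x (q - δ))
  set p' := max δ (min x (q + δ))
  have hδp : δ ≤ p := le_max_left _ _
  have hδp' : δ ≤ p' := le_max_left _ _
  have hpp' : p ≤ p' := max_le_max le_rfl (min_le_min le_rfl (by linarith))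
  have hpx : p' ≤ x := max_le hx (min_le_left _ _)
  have h1 : ‖∫ r in δ..p, osc ξ σ r‖ ≤ 2 * δ := by
    rcases hδp.eq_or_lt with h | h
    · rw [← h]
      simp [hδ.le]
    · have hpq : p ≤ q - δ := by
        rcases le_max_iff.1 (le_refl p) with h' | h'
        · linarith
        · exact h'.trans (min_le_right _ _)
      have hfar : ∀ r, r ≤ p → δ ≤ |r - q| := fun r hr => by
        rw [abs_sub_comm]
        exact le_trans (by linarith) (le_abs_self _)
      exact (norm_integral_osc_le_of_monotone (B := δ / 2) hδ hδp
        (fun r hr => hne r hr.1 (hfar r hr.2)) (Or.inr fun r _ => hsgn r)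
        (hinv _ le_rfl (hfar _ hδp)) (hinv _ hδp (hfar _ le_rfl))).trans (by linarith)
  have h2 : ‖∫ r in p..p', osc ξ σ r‖ ≤ 2 * δ := by
    refine (norm_integral_osc_le ξ σ hpp').trans ?_
    have : p' ≤ p + 2 * δ := by
      refine max_le (by linarith) ?_
      have h3 : min x (q - δ) ≤ p := le_max_right _ _
      rcases min_le_iff.1 h3 with h' | h'
      · exact (min_le_left _ _).trans (by linarith)
      · exact (min_le_right _ _).trans (by linarith)
    linarith
  have h3 : ‖∫ r in p'..x, osc ξ σ r‖ ≤ 2 * δ := by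
    rcases hpx.eq_or_lt with h | h
    · rw [← h]
      simp [hδ.le]
    · have hpq : q + δ ≤ p' := by
        by_contra! hc
        have : min x (q + δ) ≤ p' := le_max_right _ _
        rcases min_le_iff.1 this with h' | h' <;> linarith
      have hfar : ∀ r, p' ≤ r → δ ≤ |r - q| := fun r hr =>
        le_trans (by linarith) (le_abs_self _)
      exact (norm_integral_osc_le_of_monotone (B := δ / 2) (hδ.trans_le hδp') hpx
        (fun r hr => hne r (hδp'.trans hr.1) (hfar r hr.1)) (Or.inr fun r _ => hsgn r)
        (hinv _ hδp' (hfar _ le_rfl)) (hinv _ hx (hfar _ hpx))).trans (by linarith)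
  exact (norm_integral_osc_le_add (norm_integral_osc_le_add h1 h2) h3).trans (by linarith)

lemma osc_neg_neg (ξ σ r : ℝ) : osc (-ξ) (-σ) r = (starRingEnd ℂ) (osc ξ σ r) := by
  unfold osc
  rw [← Complex.exp_conj, map_mul, Complex.conj_ofReal, Complex.conj_I]
  congr 1
  push_cast
  ring

/-- Uniform decay of the primitive of `osc`, with the phase parameter `σ` arbitrary. -/
lemma norm_integral_osc_le_inv_sqrt {ξ : ℝ} (hξ : ξ ≠ 0) (σ : ℝ) {x : ℝ} (hx : 0 ≤ x) :
    ‖∫ r in (0 : ℝ)..x, osc ξ σ r‖ ≤ 7 / Real.sqrt |ξ| := by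
  have main : ∀ ξ σ : ℝ, 0 < ξ → ‖∫ r in (0 : ℝ)..x, osc ξ σ r‖ ≤ 7 / Real.sqrt ξ := by
    intro ξ σ hξ
    have hs : 0 < Real.sqrt ξ := Real.sqrt_pos.2 hξ
    set δ := 1 / Real.sqrt ξ with hδ
    have hδ0 : 0 < δ := by positivity
    have hξδ : ξ * δ ^ 2 = 1 := by
      rw [hδ, div_pow, Real.sq_sqrt hξ.le]
      field_simp
    have h7 : 7 / Real.sqrt ξ = 7 * δ := by rw [hδ]; ring
    rw [h7]
    rcases le_total x δ with h | h
    · exact (norm_integral_osc_le ξ σ hx).trans (by linarith)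
    · have h1 := norm_integral_osc_le ξ σ hδ0.le
      have h2 : ‖∫ r in δ..x, osc ξ σ r‖ ≤ 6 * δ := by
        rcases le_or_gt 0 σ with hσ | hσ
        · exact (norm_integral_osc_le_of_nonneg hξ hδ0 hξδ hσ h).trans (by linarith)
        · exact norm_integral_osc_le_of_neg hξ hδ0 hξδ hσ h
      exact (norm_integral_osc_le_add h1 h2).trans (by linarith)
  rcases hξ.lt_or_gt with h | h
  · have := main (-ξ) (-σ) (by linarith)
    simp_rw [osc_neg_neg] at this
    rw [intervalIntegral.integral_of_le hx, integral_conj, RCLike.norm_conj,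
      ← intervalIntegral.integral_of_le hx] at this
    rwa [abs_of_neg h]
  · rw [abs_of_pos h]
    exact main ξ σ h

lemma continuousOn_mul_osc {P : ℝ → ℂ} (hP : ContinuousOn P (Set.Icc 0 1)) (hP0 : P 0 = 0)
    (ξ σ : ℝ) : ContinuousOn (fun r => P r * osc ξ σ r) (Set.Icc 0 1) := by
  intro r hr
  rcases hr.1.eq_or_lt with h | h
  · subst h
    have h1 : Filter.Tendsto P (nhdsWithin 0 (Set.Icc 0 1)) (nhds 0) := by
      simpa [ContinuousWithinAt, hP0] using hP 0 hr
    have h2 : Filter.Tendsto (fun r => P r * osc ξ σ r) (nhdsWithin 0 (Set.Icc 0 1)) (nhds 0) := by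
      rw [tendsto_zero_iff_norm_tendsto_zero] at h1 ⊢
      simpa [norm_osc] using h1
    simpa [ContinuousWithinAt, hP0] using h2
  · exact (hP r hr).mul (continuousAt_osc ξ σ h).continuousWithinAt

lemma norm_integral_mul_osc_le_inv_sqrt {f : ℝ → ℂ} (hf : ContDiff ℝ (⊤ : ℕ∞) f) (hf1 : f 1 = 0)
    {ξ : ℝ} (hξ : ξ ≠ 0) (σ : ℝ) :
    ‖∫ r in (0 : ℝ)..1, f r * osc ξ σ r‖ ≤
      7 * (∫ r in (0 : ℝ)..1, ‖deriv f r‖) / Real.sqrt |ξ| := by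
  set G : ℝ → ℂ := fun x => ∫ r in (0 : ℝ)..x, osc ξ σ r with hG
  have hGc : Continuous G :=
    intervalIntegral.continuous_primitive (fun a b => intervalIntegrable_osc ξ σ a b) 0
  have hf' : Continuous (deriv f) := hf.continuous_deriv (by simp)
  have hi1 := intervalIntegrable_mul_osc (a := 0) (b := 1) hf.continuous.continuousOn ξ σ
  have hi2 : IntervalIntegrable (fun r => deriv f r * G r) volume 0 1 :=
    (hf'.mul hGc).intervalIntegrable _ _
  have key : ∫ r in (0 : ℝ)..1, (deriv f r * G r + f r * osc ξ σ r) = f 1 * G 1 - f 0 * G 0 := by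
    refine intervalIntegral.integral_eq_sub_of_hasDerivAt_of_le (f := fun r => f r * G r)
      zero_le_one (hf.continuous.mul hGc).continuousOn ?_ (hi2.add hi1)
    intro r hr
    have h1 : HasDerivAt f (deriv f r) r := ((hf.differentiable (by simp)) r).hasDerivAt
    have h2 : HasDerivAt G (osc ξ σ r) r :=
      intervalIntegral.integral_hasDerivAt_right (intervalIntegrable_osc ξ σ 0 r)
        (measurable_osc ξ σ).stronglyMeasurable.stronglyMeasurableAtFilter
        (continuousAt_osc ξ σ hr.1)
    exact h1.mul h2
  rw [intervalIntegral.integral_add hi2 hi1, hf1] at key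
  have hG0 : G 0 = 0 := by simp [hG]
  rw [hG0, zero_mul, mul_zero, sub_zero, ← eq_neg_iff_add_eq_zero] at key
  rw [← norm_neg, ← key]
  have hb : ∫ r in (0 : ℝ)..1, ‖deriv f r‖ * (7 / Real.sqrt |ξ|) =
      7 * (∫ r in (0 : ℝ)..1, ‖deriv f r‖) / Real.sqrt |ξ| := by
    rw [intervalIntegral.integral_mul_const]
    ring
  rw [← hb]
  refine intervalIntegral.norm_integral_le_of_norm_le zero_le_one ?_
    ((hf'.norm.mul continuous_const).intervalIntegrable _ _)
  refine Filter.Eventually.of_forall fun r hr => ?_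
  rw [norm_mul]
  gcongr
  exact norm_integral_osc_le_inv_sqrt hξ σ hr.1.le

lemma exists_norm_integral_mul_le {f : ℝ → ℂ} (hf : Continuous f) :
    ∃ M : ℝ, 0 ≤ M ∧ ∀ (w : ℝ → ℂ) (B : ℝ), (∀ r ∈ Set.Icc (0 : ℝ) 1, ‖w r‖ ≤ B) →
      ‖∫ r in (0 : ℝ)..1, w r * f r‖ ≤ B * M := by
  obtain ⟨M, hM⟩ := isCompact_Icc.exists_bound_of_continuousOn
    (hf.continuousOn (s := Set.Icc (0 : ℝ) 1))
  have hM0 : 0 ≤ M := (norm_nonneg _).trans (hM 0 (by simp))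
  refine ⟨M, hM0, fun w B hw => ?_⟩
  have := intervalIntegral.norm_integral_le_of_norm_le_const (a := (0 : ℝ)) (b := 1) (C := B * M)
    (f := fun r => w r * f r) (fun r hr => by
      rw [Set.uIoc_of_le zero_le_one] at hr
      have hr' : r ∈ Set.Icc (0 : ℝ) 1 := ⟨hr.1.le, hr.2⟩
      rw [norm_mul]
      exact mul_le_mul (hw r hr') (hM r hr') (norm_nonneg _) ((norm_nonneg _).trans (hw r hr')))
  simpa using this

/-- The factor `(1 + u r²)⁻¹` with `u = ξ / σ`, by which the phase derivative differs from
`2σ / r`. -/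
noncomputable def phaseCorr (ξ σ r : ℝ) : ℂ := (((1 + ξ / σ * r ^ 2)⁻¹ : ℝ) : ℂ)

lemma half_le_one_add_div_mul_sq {ξ σ r : ℝ} (hσ : σ ≠ 0) (h : 2 * |ξ| ≤ |σ|)
    (hr : r ∈ Set.Icc (0 : ℝ) 1) : 1 / 2 ≤ 1 + ξ / σ * r ^ 2 := by
  have h1 : |ξ / σ * r ^ 2| ≤ 1 / 2 := by
    have hs : 0 < |σ| := abs_pos.2 hσ
    have h2 : |ξ / σ| ≤ 1 / 2 := by
      rw [abs_div, div_le_iff₀ hs]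
      linarith
    have h3 : r ^ 2 ≤ 1 := pow_le_one₀ hr.1 hr.2
    rw [abs_mul, abs_of_nonneg (sq_nonneg r)]
    nlinarith [abs_nonneg (ξ / σ)]
  linarith [(abs_le.1 h1).1]

lemma norm_phaseCorr_le {ξ σ r : ℝ} (hσ : σ ≠ 0) (h : 2 * |ξ| ≤ |σ|)
    (hr : r ∈ Set.Icc (0 : ℝ) 1) : ‖phaseCorr ξ σ r‖ ≤ 2 := by
  have h1 := half_le_one_add_div_mul_sq hσ h hr
  have h0 : 0 < 1 + ξ / σ * r ^ 2 := by linarith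
  unfold phaseCorr
  rw [Complex.norm_real, Real.norm_of_nonneg (by positivity)]
  exact inv_le_of_inv_le₀ (by norm_num) (by linarith)

lemma continuousOn_phaseCorr {ξ σ : ℝ} (hσ : σ ≠ 0) (h : 2 * |ξ| ≤ |σ|) :
    ContinuousOn (phaseCorr ξ σ) (Set.Icc 0 1) := by
  refine Complex.continuous_ofReal.comp_continuousOn (ContinuousOn.inv₀ (by fun_prop) ?_)
  intro r hr
  linarith [half_le_one_add_div_mul_sq hσ h hr]

lemma hasDerivAt_phaseCorr {ξ σ r : ℝ} (hr : 1 + ξ / σ * r ^ 2 ≠ 0) :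
    HasDerivAt (phaseCorr ξ σ)
      (-(2 * (ξ / σ) * r : ℝ) * phaseCorr ξ σ r ^ 2) r := by
  have h1 : HasDerivAt (fun r : ℝ => 1 + ξ / σ * r ^ 2) (ξ / σ * (2 * r)) r := by
    simpa using (((hasDerivAt_id r).pow 2).const_mul (ξ / σ)).const_add 1
  refine (h1.inv hr).ofReal_comp.congr_deriv ?_
  unfold phaseCorr
  push_cast
  field_simp

lemma integral_phaseCorr_pow_mul_osc {f : ℝ → ℂ} (hf : ContDiff ℝ (⊤ : ℕ∞) f) (hf1 : f 1 = 0)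
    (k : ℕ) {ξ σ : ℝ} (hσ : σ ≠ 0) (h : 2 * |ξ| ≤ |σ|) :
    ∫ r in (0 : ℝ)..1, phaseCorr ξ σ r ^ k * f r * osc ξ σ r =
      -(Complex.I / (2 * σ)) *
        ((∫ r in (0 : ℝ)..1, phaseCorr ξ σ r ^ (k + 1) * (r * deriv f r) * osc ξ σ r) +
          (2 * k + 2) * (∫ r in (0 : ℝ)..1, phaseCorr ξ σ r ^ (k + 2) * f r * osc ξ σ r) -
          (2 * k + 1) * ∫ r in (0 : ℝ)..1, phaseCorr ξ σ r ^ (k + 1) * f r * osc ξ σ r) := by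
  have hg := continuousOn_phaseCorr hσ h
  have hfc : Continuous f := hf.continuous
  have hf'c : Continuous (deriv f) := hf.continuous_deriv (by simp)
  have hint : ∀ (j : ℕ) {v : ℝ → ℂ}, Continuous v →
      IntervalIntegrable (fun r => phaseCorr ξ σ r ^ j * v r * osc ξ σ r) volume 0 1 := by
    intro j v hv
    apply intervalIntegrable_mul_osc (f := fun r => phaseCorr ξ σ r ^ j * v r)
    rw [Set.uIcc_of_le zero_le_one]
    exact (hg.pow j).mul hv.continuousOn
  have hi0 := hint k hfc
  have hi1 := hint (k + 1) (v := fun r => r * deriv f r) (by fun_prop)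
  have hi2 := (hint (k + 2) hfc).const_mul (2 * k + 2)
  have hi3 := (hint (k + 1) hfc).const_mul (2 * k + 1)
  have hi := ((hi1.add hi2).sub hi3).const_mul (Complex.I / (2 * σ))
  have key := intervalIntegral.integral_eq_sub_of_hasDerivAt_of_le
    (f := fun r => Complex.I / (2 * σ) * (r * (phaseCorr ξ σ r ^ (k + 1) * f r)) * osc ξ σ r)
    (zero_le_one' ℝ) ?_ ?_ (hi0.add hi)
  · rw [intervalIntegral.integral_add hi0 hi, intervalIntegral.integral_const_mul,
      intervalIntegral.integral_sub (hi1.add hi2) hi3, intervalIntegral.integral_add hi1 hi2,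
      intervalIntegral.integral_const_mul, intervalIntegral.integral_const_mul] at key
    simp only [hf1, mul_zero, zero_mul, Complex.ofReal_zero, sub_zero] at key
    linear_combination key
  · refine continuousOn_mul_osc (P := fun r =>
      Complex.I / (2 * σ) * (r * (phaseCorr ξ σ r ^ (k + 1) * f r))) ?_ (by simp) ξ σ
    exact continuousOn_const.mul (Complex.continuous_ofReal.continuousOn.mul
      ((hg.pow _).mul hfc.continuousOn))
  · intro r hr
    have hrI : r ∈ Set.Icc (0 : ℝ) 1 := Set.Ioo_subset_Icc_self hr
    have hne : 1 + ξ / σ * r ^ 2 ≠ 0 := by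
      linarith [half_le_one_add_div_mul_sq hσ h hrI]
    have hdf : HasDerivAt f (deriv f r) r := ((hf.differentiable (by simp)) r).hasDerivAt
    have hid : HasDerivAt (fun r : ℝ => (r : ℂ)) 1 r := by
      simpa using (hasDerivAt_id r).ofReal_comp
    refine (((hid.mul (((hasDerivAt_phaseCorr hne).pow (k + 1)).mul hdf)).const_mul
      (Complex.I / (2 * σ))).mul (hasDerivAt_osc ξ σ hr.1)).congr_deriv ?_
    have hrC : (r : ℂ) ≠ 0 := by exact_mod_cast hr.1.ne'
    have hσC : (σ : ℂ) ≠ 0 := by exact_mod_cast hσ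
    have hgC : phaseCorr ξ σ r * (1 + ξ / σ * r ^ 2) = 1 := by
      unfold phaseCorr
      exact_mod_cast inv_mul_cancel₀ hne
    have hcoef : Complex.I / (2 * σ) * r * (((-(2 * ξ * r + 2 * σ / r) : ℝ) : ℂ) * Complex.I) =
        1 + ξ / σ * r ^ 2 := by
      push_cast
      field_simp
      linear_combination (-(ξ * r ^ 2 + σ)) * Complex.I_sq
    simp only [Nat.add_sub_cancel, Pi.mul_apply, Pi.pow_apply]
    push_cast at hcoef ⊢
    set g := phaseCorr ξ σ r
    set E := osc ξ σ r
    set c := Complex.I / (2 * (σ : ℂ))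
    set u := (ξ : ℂ) / σ
    linear_combination (g ^ (k + 1) * f r * E) * hcoef + (g ^ k * f r * E) * hgC -
      (c * (k + 1) * 2 * g ^ (k + 1) * f r * E) * hgC

lemma eq_zero_at_one {f : ℝ → ℂ} (hf : Continuous f) (h : ∀ r, 1 < r → f r = 0) : f 1 = 0 := by
  have h1 : Filter.Tendsto f (nhdsWithin 1 (Set.Ioi 1)) (nhds (f 1)) :=
    hf.continuousAt.continuousWithinAt
  have h2 : Filter.Tendsto f (nhdsWithin 1 (Set.Ioi 1)) (nhds 0) :=
    tendsto_const_nhds.congr' (by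
      filter_upwards [self_mem_nhdsWithin] with r hr using (h r hr).symm)
  exact tendsto_nhds_unique h1 h2

lemma exists_norm_integral_osc_le_div_pow (n : ℕ) : ∀ (f : ℝ → ℂ) (k : ℕ),
    ContDiff ℝ (⊤ : ℕ∞) f → (∀ r, 1 < r → f r = 0) →
    ∃ C : ℝ, 0 ≤ C ∧ ∀ ξ σ : ℝ, σ ≠ 0 → 2 * |ξ| ≤ |σ| →
      ‖∫ r in (0 : ℝ)..1, phaseCorr ξ σ r ^ k * f r * osc ξ σ r‖ ≤ C / |σ| ^ n := by
  induction n with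
  | zero =>
    intro f k hf _
    obtain ⟨M, hM0, hM⟩ := exists_norm_integral_mul_le hf.continuous
    refine ⟨2 ^ k * M, by positivity, fun ξ σ hσ h => ?_⟩
    have := hM (fun r => phaseCorr ξ σ r ^ k * osc ξ σ r) (2 ^ k) (fun r hr => by
      rw [norm_mul, norm_osc, mul_one, norm_pow]
      exact pow_le_pow_left₀ (norm_nonneg _) (norm_phaseCorr_le hσ h hr) k)
    simpa [mul_right_comm] using this
  | succ n ih =>
    intro f k hf hsupp
    have hdf : ContDiff ℝ (⊤ : ℕ∞) (fun r : ℝ => (r : ℂ) * deriv f r) :=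
      Complex.ofRealCLM.contDiff.mul (contDiff_infty_iff_deriv.1 hf).2
    have hdsupp : ∀ r : ℝ, 1 < r → (r : ℂ) * deriv f r = 0 := by
      intro r hr
      have : f =ᶠ[nhds r] fun _ => 0 := by
        filter_upwards [Ioi_mem_nhds hr] with x hx using hsupp x hx
      rw [this.deriv_eq]
      simp
    obtain ⟨C1, h10, h1⟩ := ih _ (k + 1) hdf hdsupp
    obtain ⟨C2, h20, h2⟩ := ih f (k + 2) hf hsupp
    obtain ⟨C3, h30, h3⟩ := ih f (k + 1) hf hsupp
    refine ⟨(C1 + (2 * k + 2) * C2 + (2 * k + 1) * C3) / 2, by positivity, fun ξ σ hσ h => ?_⟩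
    have hs : 0 < |σ| := abs_pos.2 hσ
    rw [integral_phaseCorr_pow_mul_osc hf (eq_zero_at_one hf.continuous hsupp) k hσ h, norm_mul]
    have hc : ‖-(Complex.I / (2 * (σ : ℂ)))‖ = 1 / (2 * |σ|) := by simp
    have hk2 : ‖(2 * k + 2 : ℂ)‖ = 2 * k + 2 := by
      exact_mod_cast Complex.norm_natCast (2 * k + 2)
    have hk1 : ‖(2 * k + 1 : ℂ)‖ = 2 * k + 1 := by
      exact_mod_cast Complex.norm_natCast (2 * k + 1)
    rw [hc]
    calc _ ≤ 1 / (2 * |σ|) * (C1 / |σ| ^ n + (2 * k + 2) * (C2 / |σ| ^ n) +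
          (2 * k + 1) * (C3 / |σ| ^ n)) := by
          gcongr
          refine norm_sub_le_of_le (norm_add_le_of_le (h1 ξ σ hσ h) ?_) ?_
          · rw [norm_mul, hk2]
            gcongr
            exact h2 ξ σ hσ h
          · rw [norm_mul, hk1]
            gcongr
            exact h3 ξ σ hσ h
      _ = _ := by
          field_simp
          ring

lemma psiFlat_integrand_comp_sq (ψ : ℝ → ℂ) (ξ σ : ℝ) {r : ℝ} (hr : 0 < r) :
    (|(2 : ℝ)| * r ^ ((2 : ℝ) - 1)) • (ψ (r ^ (2 : ℝ)) *
      Complex.exp (-Complex.I * (ξ : ℂ) * ((r ^ (2 : ℝ) : ℝ) : ℂ)) *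
        rpowC |r ^ (2 : ℝ)| (-(1 / 2) - σ * Complex.I)) = 2 * (ψ (r ^ 2) * osc ξ σ r) := by
  have h1 : r ^ ((2 : ℝ) - 1) = r := by norm_num
  have hrC : Complex.exp (Real.log r : ℂ) = r := by
    rw [← Complex.ofReal_exp, Real.exp_log hr]
  have hexp : (r : ℂ) * (Complex.exp (-Complex.I * (ξ : ℂ) * ((r ^ 2 : ℝ) : ℂ)) *
      rpowC (r ^ 2) (-(1 / 2) - σ * Complex.I)) = osc ξ σ r := by
    unfold rpowC osc
    nth_rewrite 1 [← hrC]
    rw [← Complex.exp_add, ← Complex.exp_add, Real.log_pow]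
    congr 1
    push_cast
    ring
  rw [h1, Real.rpow_two, abs_of_pos two_pos, abs_of_pos (by positivity : 0 < r ^ 2), ← hexp,
    Complex.real_smul]
  push_cast
  ring

lemma integral_Ioi_psiFlat_integrand {ψ : ℝ → ℂ} (hψ : Continuous ψ) (h0 : ∀ t, 1 < t → ψ t = 0)
    (ξ σ : ℝ) :
    IntegrableOn (fun t : ℝ => ψ t * Complex.exp (-Complex.I * (ξ : ℂ) * (t : ℂ)) *
        rpowC |t| (-(1 / 2) - σ * Complex.I)) (Set.Ioi 0) ∧
      ∫ t in Set.Ioi (0 : ℝ), ψ t * Complex.exp (-Complex.I * (ξ : ℂ) * (t : ℂ)) *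
        rpowC |t| (-(1 / 2) - σ * Complex.I) =
      2 * ∫ r in (0 : ℝ)..1, ψ (r ^ 2) * osc ξ σ r := by
  have hzero : ∀ r ∈ Set.Ioi (0 : ℝ) \ Set.Ioc 0 1, 2 * (ψ (r ^ 2) * osc ξ σ r) = 0 := by
    intro r hr
    have h1 : 1 < r := by
      by_contra! h
      exact hr.2 ⟨hr.1, h⟩
    rw [h0 _ (one_lt_pow₀ h1 two_ne_zero)]
    simp
  have hcongr : Set.EqOn (fun r : ℝ => (|(2 : ℝ)| * r ^ ((2 : ℝ) - 1)) • (ψ (r ^ (2 : ℝ)) *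
      Complex.exp (-Complex.I * (ξ : ℂ) * ((r ^ (2 : ℝ) : ℝ) : ℂ)) *
        rpowC |r ^ (2 : ℝ)| (-(1 / 2) - σ * Complex.I)))
      (fun r => 2 * (ψ (r ^ 2) * osc ξ σ r)) (Set.Ioi 0) :=
    fun r hr => psiFlat_integrand_comp_sq ψ ξ σ hr
  have hint : IntervalIntegrable (fun r => ψ (r ^ 2) * osc ξ σ r) volume 0 1 :=
    intervalIntegrable_mul_osc (f := fun r => ψ (r ^ 2)) (by fun_prop) ξ σ
  constructor
  · rw [← integrableOn_Ioi_comp_rpow_iff _ (two_ne_zero : (2 : ℝ) ≠ 0),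
      integrableOn_congr_fun hcongr measurableSet_Ioi]
    exact ((intervalIntegrable_iff_integrableOn_Ioc_of_le zero_le_one).1
      (hint.const_mul 2)).of_forall_sdiff_eq_zero measurableSet_Ioi hzero
  · rw [← integral_comp_rpow_Ioi _ (two_ne_zero : (2 : ℝ) ≠ 0),
      setIntegral_congr_fun measurableSet_Ioi hcongr,
      setIntegral_eq_of_subset_of_forall_sdiff_eq_zero measurableSet_Ioi
        Set.Ioc_subset_Ioi_self hzero, ← intervalIntegral.integral_of_le zero_le_one,
      intervalIntegral.integral_const_mul]

lemma psiFlat_eq {ψ : ℝ → ℂ} (hψ : Continuous ψ)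
    (hsupp : Function.support ψ ⊆ Set.Icc (-1 : ℝ) 1) (ξ σ : ℝ) :
    psiFlat ψ ξ (σ * Complex.I) = 2 * (∫ r in (0 : ℝ)..1, ψ (r ^ 2) * osc ξ σ r) +
      2 * ∫ r in (0 : ℝ)..1, ψ (-r ^ 2) * osc (-ξ) σ r := by
  have h0 : ∀ t, 1 < |t| → ψ t = 0 := by
    intro t ht
    by_contra h
    exact absurd (abs_le.2 (hsupp h)) (not_le.2 ht)
  obtain ⟨hp, hp'⟩ := integral_Ioi_psiFlat_integrand hψ
    (fun t ht => h0 t (ht.trans_le (le_abs_self t))) ξ σ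
  obtain ⟨hn, hn'⟩ := integral_Ioi_psiFlat_integrand (ψ := fun t => ψ (-t)) (by fun_prop)
    (fun t ht => h0 (-t) (by rw [abs_neg]; exact ht.trans_le (le_abs_self t))) (-ξ) σ
  set F : ℝ → ℂ := fun t => ψ t * Complex.exp (-Complex.I * (ξ : ℂ) * (t : ℂ)) *
    rpowC |t| (-(1 / 2) - σ * Complex.I) with hF
  have hFn : (fun t : ℝ => ψ (-t) * Complex.exp (-Complex.I * ((-ξ : ℝ) : ℂ) * (t : ℂ)) *
      rpowC |t| (-(1 / 2) - σ * Complex.I)) = fun t => F (-t) := by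
    funext t
    simp only [hF, abs_neg, Complex.ofReal_neg]
    ring_nf
  rw [hFn] at hn hn'
  have hneg : IntegrableOn F (Set.Iic 0) := by
    have := IntegrableOn.comp_neg_Iic (c := (0 : ℝ)) (f := fun t => F (-t)) (μ := volume)
      (by rw [neg_zero]; exact (integrableOn_Ici_iff_integrableOn_Ioi (by simp)).2 hn)
    simpa using this
  rw [integral_comp_neg_Ioi, neg_zero] at hn'
  unfold psiFlat
  rw [← intervalIntegral.integral_Iic_add_Ioi hneg hp, hp', hn', add_comm]

lemma inv_sqrt_le_rpow {x : ℝ} (hx : 1 ≤ x) : 1 / Real.sqrt x ≤ 2 * (1 + x) ^ (-(1 : ℝ) / 2) := by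
  rw [neg_div, Real.rpow_neg (by linarith), ← Real.sqrt_eq_rpow, ← div_eq_mul_inv,
    div_le_div_iff₀ (Real.sqrt_pos.2 (by linarith)) (Real.sqrt_pos.2 (by linarith)), one_mul]
  refine Real.sqrt_le_iff.2 ⟨by positivity, ?_⟩
  rw [mul_pow, Real.sq_sqrt (by linarith)]
  linarith

lemma one_le_two_mul_rpow {x : ℝ} (h0 : 0 ≤ x) (hx : x ≤ 1) :
    1 ≤ 2 * (1 + x) ^ (-(1 : ℝ) / 2) := by
  rw [neg_div, Real.rpow_neg (by linarith), ← Real.sqrt_eq_rpow, ← div_eq_mul_inv,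
    le_div_iff₀ (Real.sqrt_pos.2 (by linarith)), one_mul]
  exact Real.sqrt_le_iff.2 ⟨by norm_num, by linarith⟩

/-- The two bounds for the half-line integral in the variable `r = √|t|`. -/
lemma exists_norm_integral_osc_bounds {f : ℝ → ℂ} (hf : ContDiff ℝ (⊤ : ℕ∞) f)
    (hsupp : ∀ r, 1 < r → f r = 0) :
    ∃ C : ℝ, 0 ≤ C ∧ ∀ ξ σ : ℝ,
      ‖∫ r in (0 : ℝ)..1, f r * osc ξ σ r‖ ≤ C * (1 + |ξ|) ^ (-(1 : ℝ) / 2) ∧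
      (2 * |ξ| ≤ |σ| →
        ‖∫ r in (0 : ℝ)..1, f r * osc ξ σ r‖ ≤ C * (1 + |σ|) ^ (-(3 : ℝ))) := by
  obtain ⟨M, hM0, hM⟩ := exists_norm_integral_mul_le hf.continuous
  obtain ⟨C, hC0, hC⟩ := exists_norm_integral_osc_le_div_pow 3 f 0 hf hsupp
  have htriv : ∀ ξ σ : ℝ, ‖∫ r in (0 : ℝ)..1, f r * osc ξ σ r‖ ≤ M := by
    intro ξ σ
    simpa [mul_comm] using hM (osc ξ σ) 1 (fun r _ => (norm_osc ξ σ r).le)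
  set V := ∫ r in (0 : ℝ)..1, ‖deriv f r‖
  have hV0 : 0 ≤ V := intervalIntegral.integral_nonneg zero_le_one (fun _ _ => norm_nonneg _)
  refine ⟨8 * M + 14 * V + 8 * C, by positivity, fun ξ σ => ⟨?_, fun h => ?_⟩⟩
  · have hpos : 0 ≤ (1 + |ξ|) ^ (-(1 : ℝ) / 2) := by positivity
    rcases le_total |ξ| 1 with h1 | h1
    · have := one_le_two_mul_rpow (abs_nonneg ξ) h1
      calc _ ≤ M * 1 := by simpa using htriv ξ σ
        _ ≤ M * (2 * (1 + |ξ|) ^ (-(1 : ℝ) / 2)) := by gcongr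
        _ = (2 * M) * (1 + |ξ|) ^ (-(1 : ℝ) / 2) := by ring
        _ ≤ _ := by
          gcongr
          linarith
    · have hξ : ξ ≠ 0 := abs_pos.1 (by linarith)
      calc _ ≤ 7 * V * (1 / Real.sqrt |ξ|) := by
            rw [mul_one_div]
            exact norm_integral_mul_osc_le_inv_sqrt hf
              (eq_zero_at_one hf.continuous hsupp) hξ σ
        _ ≤ 7 * V * (2 * (1 + |ξ|) ^ (-(1 : ℝ) / 2)) := by
            gcongr
            exact inv_sqrt_le_rpow h1
        _ = (14 * V) * (1 + |ξ|) ^ (-(1 : ℝ) / 2) := by ring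
        _ ≤ _ := by
          gcongr
          linarith
  · have hσ0 := abs_nonneg σ
    have hrp : (1 + |σ|) ^ (-(3 : ℝ)) = 1 / (1 + |σ|) ^ 3 := by
      rw [Real.rpow_neg (by linarith), one_div]
      norm_cast
    rw [hrp, mul_one_div]
    rcases le_total |σ| 1 with h1 | h1
    · have h2 : (1 + |σ|) ^ 3 ≤ 2 ^ 3 := pow_le_pow_left₀ (by linarith) (by linarith) 3
      rw [le_div_iff₀ (by positivity)]
      calc _ ≤ M * 2 ^ 3 := mul_le_mul (htriv ξ σ) h2 (by positivity) hM0
        _ ≤ _ := by linarith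
    · have hσ : σ ≠ 0 := abs_pos.1 (by linarith)
      have h2 : (1 + |σ|) ^ 3 ≤ (2 * |σ|) ^ 3 := pow_le_pow_left₀ (by linarith) (by linarith) 3
      rw [le_div_iff₀ (by positivity)]
      have h3 : ‖∫ r in (0 : ℝ)..1, f r * osc ξ σ r‖ ≤ C / |σ| ^ 3 := by
        simpa using hC ξ σ hσ h
      calc _ ≤ C / |σ| ^ 3 * (2 * |σ|) ^ 3 := mul_le_mul h3 h2 (by positivity) (by positivity)
        _ = 8 * C := by
          field_simp
          norm_num
        _ ≤ _ := by linarith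

/-- Lemma 3.3 of the paper. -/
theorem spherical_flat_transform_bounds
    (ψ : ℝ → ℂ) (hψ_smooth : ContDiff ℝ (⊤ : ℕ∞) ψ)
    (hψ_supp : Function.support ψ ⊆ Set.Icc (-1 : ℝ) 1) :
    ∃ c : ℝ, 0 < c ∧
      (∀ s : ℂ, ∀ ξ : ℝ, s.re = 0 → ‖s‖ ≤ 2 * |ξ| →
        ‖psiFlat ψ ξ s‖ ≤ c * (1 + |ξ|) ^ (-(1 : ℝ) / 2)) ∧
      (∀ s : ℂ, ∀ ξ : ℝ, s.re = 0 → 2 * |ξ| ≤ ‖s‖ →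
        ‖psiFlat ψ ξ s‖ ≤ c * (1 + ‖s‖) ^ (-(3 : ℝ))) := by
  have hvanish : ∀ t, 1 < |t| → ψ t = 0 := by
    intro t ht
    by_contra h
    exact absurd (abs_le.2 (hψ_supp h)) (not_le.2 ht)
  have hsq : ∀ r : ℝ, 1 < r → 1 < |r ^ 2| := fun r hr =>
    (one_lt_pow₀ hr two_ne_zero).trans_le (le_abs_self _)
  obtain ⟨A, hA0, hA⟩ := exists_norm_integral_osc_bounds (f := fun r => ψ (r ^ 2))
    (hψ_smooth.comp (by fun_prop)) (fun r hr => hvanish _ (hsq r hr))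
  obtain ⟨B, hB0, hB⟩ := exists_norm_integral_osc_bounds (f := fun r => ψ (-r ^ 2))
    (hψ_smooth.comp (by fun_prop)) (fun r hr => hvanish _ (by rw [abs_neg]; exact hsq r hr))
  have hs_eq : ∀ s : ℂ, s.re = 0 → s = s.im * Complex.I := fun s hs => by
    apply Complex.ext <;> simp [hs]
  have hs_norm : ∀ s : ℂ, s.re = 0 → ‖s‖ = |s.im| := fun s hs => by
    rw [hs_eq s hs]
    simp
  have hsum : ∀ {x y : ℂ} {w : ℝ}, 0 ≤ w → ‖x‖ ≤ A * w → ‖y‖ ≤ B * w →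
      ‖2 * x + 2 * y‖ ≤ (2 * A + 2 * B + 1) * w := by
    intro x y w hw hx hy
    have : ‖2 * x + 2 * y‖ ≤ 2 * ‖x‖ + 2 * ‖y‖ := by
      simpa using norm_add_le (2 * x) (2 * y)
    linarith
  refine ⟨2 * A + 2 * B + 1, by positivity, fun s ξ hs _ => ?_, fun s ξ hs h => ?_⟩
  · rw [hs_eq s hs, psiFlat_eq hψ_smooth.continuous hψ_supp]
    refine hsum (by positivity) (hA ξ s.im).1 ?_
    simpa using (hB (-ξ) s.im).1
  · rw [hs_norm s hs] at h ⊢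
    rw [hs_eq s hs, psiFlat_eq hψ_smooth.continuous hψ_supp, ← hs_eq s hs]
    exact hsum (by positivity) ((hA ξ s.im).2 h) ((hB (-ξ) s.im).2 (by rwa [abs_neg]))
end
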